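/- arXiv:1909.11530 — 6 statements merged into one kernel-verified Lean document; each statement's English description precedes it below -/
import Mathlib

section
/- Let (X,d) be a complete and connected metric space with 0 < ℋ¹(X) < ∞, equipped with the measure ℋ¹, and suppose there is a constant C₀ > 0 such that liminf_{r→0} ℋ¹(B(x,r))/r < C₀ for every x ∈ X. Then there is a constant C depending only on C₀ (one may take C = C₀(3+4C₀)) such that every function u : X → ℝ with Var(u,X) < ∞ satisfies ‖Du‖(X) ≤ C·Var(u,X); in particular ‖Du‖(X) < ∞. -/
open MeasureTheory Set Filter Topology ENNReal

/-- A rectifiable curve parametrized by arc length: a map defined (in effect) on `[0, len]`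
whose variation on every subinterval `[s,t] ⊆ [0,len]` equals `t - s`. -/
structure MCurve (X : Type*) [MetricSpace X] where
  len : ℝ
  len_nonneg : 0 ≤ len
  toFun : ℝ → X
  arclength : ∀ s t : ℝ, s ∈ Set.Icc 0 len → t ∈ Set.Icc 0 len → s ≤ t →
    eVariationOn toFun (Set.Icc s t) = ENNReal.ofReal (t - s)

namespace MCurve

variable {X : Type*} [MetricSpace X]

/-- The image of a curve. -/
def image (γ : MCurve X) : Set X := γ.toFun '' Set.Icc 0 γ.len

/-- A curve is simple (injective) if its parametrization is injective on `[0, len]`. -/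
def IsSimple (γ : MCurve X) : Prop := Set.InjOn γ.toFun (Set.Icc 0 γ.len)

end MCurve

/-- Pointwise variation `pV(v, X)`: supremum over finite collections of pairwise disjoint
injective arc-length parametrized curves of the sums of endpoint differences. -/
noncomputable def pVar {X : Type*} [MetricSpace X] (v : X → ℝ) : ℝ≥0∞ :=
  ⨆ (n : ℕ) (γ : Fin n → MCurve X) (_ : ∀ i, (γ i).IsSimple)
    (_ : ∀ i j, i ≠ j → Disjoint (γ i).image (γ j).image),
    ∑ i, ENNReal.ofReal |v ((γ i).toFun (γ i).len) - v ((γ i).toFun 0)|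

/-- Pointwise variation `pV_D(v, X)` with curve endpoints restricted to lie in `D`. -/
noncomputable def pVarOn {X : Type*} [MetricSpace X] (D : Set X) (v : X → ℝ) : ℝ≥0∞ :=
  ⨆ (n : ℕ) (γ : Fin n → MCurve X) (_ : ∀ i, (γ i).IsSimple)
    (_ : ∀ i j, i ≠ j → Disjoint (γ i).image (γ j).image)
    (_ : ∀ i, (γ i).toFun 0 ∈ D ∧ (γ i).toFun (γ i).len ∈ D),
    ∑ i, ENNReal.ofReal |v ((γ i).toFun (γ i).len) - v ((γ i).toFun 0)|

/-- `Var(u, X)`: infimum of `pV(v, X)` over representatives `v = u` a.e. -/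
noncomputable def VarH {X : Type*} [MetricSpace X] [MeasurableSpace X]
    (μ : Measure X) (u : X → ℝ) : ℝ≥0∞ :=
  ⨅ (v : X → ℝ) (_ : v =ᵐ[μ] u), pVar v

/-- `g` is an upper gradient of `u`: `g` is Borel and the upper gradient inequality holds
along every arc-length parametrized rectifiable curve. -/
def IsUpperGradient {X : Type*} [MetricSpace X] [MeasurableSpace X]
    (u : X → ℝ) (g : X → ℝ≥0∞) : Prop :=
  Measurable g ∧ ∀ γ : MCurve X,
    ENNReal.ofReal |u (γ.toFun γ.len) - u (γ.toFun 0)| ≤ ∫⁻ s in Set.Icc 0 γ.len, g (γ.toFun s)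

/-- The total variation `‖Du‖(X)`: infimum of `liminf ∫ gᵢ dμ` over sequences `uᵢ → u` in
`L¹(X, μ)` with upper gradients `gᵢ`. -/
noncomputable def totalVarH {X : Type*} [MetricSpace X] [MeasurableSpace X]
    (μ : Measure X) (u : X → ℝ) : ℝ≥0∞ :=
  ⨅ (ui : ℕ → X → ℝ) (gi : ℕ → X → ℝ≥0∞) (_ : ∀ i, IsUpperGradient (ui i) (gi i))
    (_ : Filter.Tendsto (fun i => ∫⁻ x, ENNReal.ofReal |ui i x - u x| ∂μ)
      Filter.atTop (nhds 0)),
    Filter.atTop.liminf (fun i => ∫⁻ x, gi i x ∂μ)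


lemma MCurve.dist_le {X : Type*} [MetricSpace X] (γ : MCurve X) {s t : ℝ}
    (hs : s ∈ Icc 0 γ.len) (ht : t ∈ Icc 0 γ.len) :
    dist (γ.toFun s) (γ.toFun t) ≤ |s - t| := by
  wlog h : s ≤ t generalizing s t
  · rw [dist_comm, abs_sub_comm]; exact this ht hs (le_of_not_ge h)
  have h1 := γ.arclength s t hs ht h
  have h2 := eVariationOn.edist_le γ.toFun (s := Icc s t) (x := s) (y := t) ⟨le_rfl, h⟩ ⟨h, le_rfl⟩
  rw [h1, edist_dist] at h2
  have h3 := (ENNReal.ofReal_le_ofReal_iff (by linarith)).1 h2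
  rw [abs_sub_comm, abs_of_nonneg (by linarith : 0 ≤ t - s)]
  exact h3

lemma MCurve.continuousOn {X : Type*} [MetricSpace X] (γ : MCurve X) :
    ContinuousOn γ.toFun (Icc 0 γ.len) := by
  have : LipschitzOnWith 1 γ.toFun (Icc 0 γ.len) := by
    apply LipschitzOnWith.of_dist_le_mul
    intro x hx y hy
    simpa [Real.dist_eq] using γ.dist_le hx hy
  exact this.continuousOn

/-- Restriction of a curve to a subinterval. -/
def MCurve.sub {X : Type*} [MetricSpace X] (γ : MCurve X) (p q : ℝ) (hp : 0 ≤ p) (hpq : p ≤ q)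
    (hq : q ≤ γ.len) : MCurve X where
  len := q - p
  len_nonneg := by linarith
  toFun := fun s => γ.toFun (p + s)
  arclength := by
    intro s t hs ht hst
    have h1 : eVariationOn (γ.toFun ∘ (fun s => p + s)) (Icc s t)
        = eVariationOn γ.toFun ((fun s => p + s) '' Icc s t) :=
      eVariationOn.comp_eq_of_monotoneOn _ _ (fun a _ b _ hab => by simpa using hab)
    have h2 : eVariationOn (fun s => γ.toFun (p + s)) (Icc s t)
        = eVariationOn (γ.toFun ∘ (fun s => p + s)) (Icc s t) := rfl
    rw [h2, h1, Set.image_const_add_Icc, γ.arclength]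
    · congr 1; ring
    · constructor <;> linarith [hs.1, hs.2]
    · constructor <;> linarith [ht.1, ht.2]
    · linarith

lemma MCurve.sub_image {X : Type*} [MetricSpace X] (γ : MCurve X) (p q : ℝ) (hp : 0 ≤ p)
    (hpq : p ≤ q) (hq : q ≤ γ.len) :
    (γ.sub p q hp hpq hq).image = γ.toFun '' Icc p q := by
  unfold MCurve.image MCurve.sub
  have : (fun s => γ.toFun (p + s)) '' Icc 0 (q - p)
      = γ.toFun '' ((fun s => p + s) '' Icc 0 (q - p)) := by
    rw [Set.image_image]
  simp only
  rw [this, Set.image_const_add_Icc]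
  simp

lemma MCurve.sub_simple {X : Type*} [MetricSpace X] (γ : MCurve X) (p q : ℝ) (hp : 0 ≤ p)
    (hpq : p ≤ q) (hq : q ≤ γ.len) (h : γ.IsSimple) : (γ.sub p q hp hpq hq).IsSimple := by
  intro a ha b hb hab
  have ha' : a ∈ Icc 0 (q - p) := ha
  have hb' : b ∈ Icc 0 (q - p) := hb
  have := h (x₁ := p + a) (x₂ := p + b) ⟨by linarith [ha'.1], by linarith [ha'.2]⟩
    ⟨by linarith [hb'.1], by linarith [hb'.2]⟩ hab
  linarith

/-- Admissible Lipschitz curves. -/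
def AdmC {X : Type*} [MetricSpace X] (K : Set X) (x y : X) (L : ℝ) (f : ℝ → X) : Prop :=
  (∀ s t, dist (f s) (f t) ≤ L * |s - t|) ∧ (∀ s, f s ∈ K) ∧ f 0 = x ∧ f 1 = y

lemma exists_min_adm {X : Type*} [MetricSpace X] {K : Set X} (hK : IsCompact K) {x y : X}
    {L0 : ℝ} {f0 : ℝ → X} (hL0 : 0 ≤ L0) (h0 : AdmC K x y L0 f0) :
    ∃ L f, 0 ≤ L ∧ AdmC K x y L f ∧ ∀ L' f', 0 ≤ L' → AdmC K x y L' f' → L ≤ L' := by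
  let A : Set (ℝ × (ℝ → X)) := (Icc 0 L0 ×ˢ Set.pi univ (fun _ => K)) ∩
    {p | (∀ s t, dist (p.2 s) (p.2 t) ≤ p.1 * |s - t|) ∧ p.2 0 = x ∧ p.2 1 = y}
  have hA : IsCompact A := by
    apply IsCompact.inter_right
    · exact isCompact_Icc.prod (isCompact_univ_pi fun _ => hK)
    · have e : {p : ℝ × (ℝ → X) | (∀ s t, dist (p.2 s) (p.2 t) ≤ p.1 * |s - t|) ∧ p.2 0 = x ∧ p.2 1 = y}
        = (⋂ s : ℝ, ⋂ t : ℝ, {p | dist (p.2 s) (p.2 t) ≤ p.1 * |s - t|}) ∩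
          ({p | p.2 0 = x} ∩ {p | p.2 1 = y}) := by
        ext p; simp
      rw [e]
      refine IsClosed.inter (isClosed_iInter fun s => isClosed_iInter fun t => ?_) 
        (IsClosed.inter ?_ ?_)
      · exact isClosed_le (by fun_prop) (by fun_prop)
      · exact isClosed_eq (by fun_prop) (by fun_prop)
      · exact isClosed_eq (by fun_prop) (by fun_prop)
  have hne : A.Nonempty := ⟨(L0, f0), ⟨⟨⟨hL0, le_rfl⟩, fun s _ => h0.2.1 s⟩, h0.1, h0.2.2⟩⟩
  obtain ⟨p, hp, hmin⟩ := hA.exists_isMinOn hne continuous_fst.continuousOn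
  refine ⟨p.1, p.2, hp.1.1.1, ⟨hp.2.1, fun s => hp.1.2 s trivial, hp.2.2⟩, ?_⟩
  intro L' f' hL' h'
  by_cases h : L' ≤ L0
  · exact hmin (a := (L', f')) ⟨⟨⟨hL', h⟩, fun s _ => h'.2.1 s⟩, h'.1, h'.2.2⟩
  · exact hp.1.1.2.trans (le_of_not_ge h)

/-- From a 1-Lipschitz curve on `[0,l]` to an admissible one. -/
lemma adm_of_lip {X : Type*} [MetricSpace X] {K : Set X} {l : ℝ} (hl : 0 ≤ l)
    (φ : ℝ → X) (h : ∀ s ∈ Icc 0 l, ∀ t ∈ Icc 0 l, dist (φ s) (φ t) ≤ |s - t|)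
    (hK : ∀ s ∈ Icc 0 l, φ s ∈ K) :
    AdmC K (φ 0) (φ l) l (fun s => φ (l * (max 0 (min 1 s)))) := by
  have hm : ∀ s : ℝ, l * (max 0 (min 1 s)) ∈ Icc 0 l := by
    intro s
    have h1 : max 0 (min 1 s) ≤ 1 := by simp
    have h2 : 0 ≤ max 0 (min 1 s) := by simp
    constructor
    · positivity
    · nlinarith
  refine ⟨?_, fun s => hK _ (hm s), by simp, by simp⟩
  intro s t
  refine (h _ (hm s) _ (hm t)).trans ?_
  rw [← mul_sub, abs_mul, abs_of_nonneg hl]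
  apply mul_le_mul_of_nonneg_left _ hl
  refine (abs_max_sub_max_le_max 0 _ 0 _).trans ?_
  simp only [sub_self, abs_zero]
  refine max_le (abs_nonneg _) ?_
  refine (abs_min_sub_min_le_max 1 _ 1 _).trans ?_
  simp

lemma exists_unit_speed {X : Type*} [MetricSpace X] {K : Set X} {x y : X} {L : ℝ} {f : ℝ → X}
    (hL : 0 ≤ L) (h : AdmC K x y L f) :
    ∃ γ : MCurve X, γ.len ≤ L ∧ γ.toFun 0 = x ∧ γ.toFun γ.len = y ∧ γ.image ⊆ K := by
  obtain ⟨h1, h2, h3, h4⟩ := h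
  have hlip : LipschitzWith L.toNNReal f := by
    apply LipschitzWith.of_dist_le_mul
    intro s t
    rw [Real.coe_toNNReal _ hL, Real.dist_eq]; exact h1 s t
  have hbv : LocallyBoundedVariationOn f (Icc 0 1) := hlip.locallyBoundedVariationOn _
  have h01 : (0:ℝ) ∈ Icc (0:ℝ) 1 := by simp
  have h11 : (1:ℝ) ∈ Icc (0:ℝ) 1 := by simp
  set V := variationOnFromTo f (Icc 0 1) 0 with hV
  have hVm : MonotoneOn V (Icc 0 1) := variationOnFromTo.monotoneOn hbv h01
  have hV0 : V 0 = 0 := by simp [hV, variationOnFromTo.self]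
  have hvar : ∀ a ∈ Icc (0:ℝ) 1, ∀ b ∈ Icc (0:ℝ) 1, a ≤ b → V b - V a ≤ L * (b - a) := by
    intro a ha b hb hab
    have e : V b - V a = variationOnFromTo f (Icc 0 1) a b := by
      have := variationOnFromTo.add hbv h01 ha hb
      simp only [hV]; linarith
    rw [e, variationOnFromTo.eq_of_le _ _ hab]
    have : eVariationOn f (Icc 0 1 ∩ Icc a b) ≤ ENNReal.ofReal (L * (b - a)) := by
      refine (eVariationOn.mono f inter_subset_right).trans ?_
      have := (hlip.lipschitzOnWith (s := univ)).comp_eVariationOn_le (f := f) (g := id) (s := Icc a b) (fun _ _ => trivial)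
      rw [Function.comp_id, eVariationOn_id_Icc] at this
      rw [ENNReal.ofReal_mul hL]; exact this
    exact ENNReal.toReal_le_of_le_ofReal (by have := mul_nonneg hL (sub_nonneg.2 hab); linarith) this
  have hVc : ContinuousOn V (Icc 0 1) := by
    have : LipschitzOnWith L.toNNReal V (Icc 0 1) := by
      apply LipschitzOnWith.of_dist_le_mul
      intro a ha b hb
      rw [Real.coe_toNNReal _ hL]
      wlog hab : a ≤ b generalizing a b
      · rw [dist_comm, dist_comm a b]; exact this b hb a ha (le_of_not_ge hab)
      rw [dist_comm, dist_comm a b, Real.dist_eq, Real.dist_eq,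
        abs_of_nonneg (sub_nonneg.2 (hVm ha hb hab)), abs_of_nonneg (sub_nonneg.2 hab)]
      exact hvar a ha b hb hab
    exact this.continuousOn
  have himg : V '' Icc 0 1 = Icc 0 (V 1) := by
    apply Subset.antisymm
    · rintro _ ⟨a, ha, rfl⟩
      exact ⟨hV0 ▸ hVm h01 ha ha.1, hVm ha h11 ha.2⟩
    · have := intermediate_value_Icc (zero_le_one (α := ℝ)) hVc
      rwa [hV0] at this
  have hunit := has_unit_speed_naturalParameterization f hbv h01
  rw [← hV, himg] at hunit
  have heq : ∀ b ∈ Icc (0:ℝ) 1, naturalParameterization f (Icc 0 1) 0 (V b) = f b := by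
    intro b hb
    exact edist_eq_zero.1 (edist_naturalParameterization_eq_zero hbv h01 hb)
  refine ⟨⟨V 1, hV0 ▸ hVm h01 h11 zero_le_one, naturalParameterization f (Icc 0 1) 0, ?_⟩, ?_, ?_, ?_, ?_⟩
  · intro s t hs ht hst
    have := hunit hs ht
    rw [inter_eq_self_of_subset_right (Icc_subset_Icc hs.1 ht.2)] at this
    simpa using this
  · have := hvar 0 h01 1 h11 zero_le_one
    simp only; linarith
  · have := heq 0 h01
    rw [hV0] at this; simp only; rw [this, h3]
  · simp only; rw [heq 1 h11, h4]
  · rintro _ ⟨s, hs, rfl⟩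
    simp only at hs ⊢
    rw [← himg] at hs
    obtain ⟨b, hb, rfl⟩ := hs
    rw [heq b hb]; exact h2 b

/-- Every curve contains a simple curve with the same endpoints. -/
lemma MCurve.exists_simple {X : Type*} [MetricSpace X] (γ : MCurve X) :
    ∃ σ : MCurve X, σ.IsSimple ∧ σ.toFun 0 = γ.toFun 0 ∧ σ.toFun σ.len = γ.toFun γ.len ∧
      σ.image ⊆ γ.image := by
  have hK : IsCompact γ.image := isCompact_Icc.image_of_continuousOn γ.continuousOn
  obtain ⟨L, f, hL, hf, hmin⟩ := exists_min_adm hK γ.len_nonneg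
    (adm_of_lip γ.len_nonneg γ.toFun (fun s hs t ht => γ.dist_le hs ht) 
      (fun s hs => mem_image_of_mem _ hs) (K := γ.image))
  obtain ⟨σ, hσL, hσ0, hσ1, hσK⟩ := exists_unit_speed hL hf
  refine ⟨σ, ?_, hσ0, hσ1, hσK⟩
  have key : ∀ p ∈ Icc 0 σ.len, ∀ q ∈ Icc 0 σ.len, p < q → σ.toFun p ≠ σ.toFun q := by
    intro p hp q hq hpq he
    let ψ : ℝ → X := fun s => if s ≤ p then σ.toFun s else σ.toFun (s + (q - p))
    have hl : 0 ≤ σ.len - (q - p) := by linarith [hp.1, hq.2]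
    have hψ0 : ψ 0 = γ.toFun 0 := by simp [ψ, hp.1, hσ0]
    have hψ1 : ψ (σ.len - (q - p)) = γ.toFun γ.len := by
      simp only [ψ]
      split_ifs with hh
      · have : q = σ.len := by linarith [hq.2]
        have : σ.len - (q - p) = p := by linarith
        rw [this, he, ← hσ1]; congr 1
      · rw [← hσ1]; congr 1; ring
    have hlip : ∀ s ∈ Icc 0 (σ.len - (q - p)), ∀ t ∈ Icc 0 (σ.len - (q - p)),
        dist (ψ s) (ψ t) ≤ |s - t| := by
      intro s hs t ht
      wlog hst : s ≤ t generalizing s t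
      · rw [dist_comm, abs_sub_comm]; exact this t ht s hs (le_of_not_ge hst)
      simp only [ψ]
      have m1 : ∀ r ∈ Icc 0 (σ.len - (q - p)), r ≤ p → r ∈ Icc 0 σ.len :=
        fun r hr h => ⟨hr.1, h.trans hp.2⟩
      have m2 : ∀ r ∈ Icc 0 (σ.len - (q - p)), r + (q - p) ∈ Icc 0 σ.len :=
        fun r hr => ⟨by linarith [hr.1], by linarith [hr.2]⟩
      split_ifs with a b b
      · exact σ.dist_le (m1 s hs a) (m1 t ht b)
      · push Not at b
        refine (dist_triangle _ (σ.toFun p) _).trans ?_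
        have e1 := σ.dist_le (m1 s hs a) hp
        rw [he] at e1 ⊢
        have e2 := σ.dist_le hq (m2 t ht)
        rw [abs_sub_comm, abs_of_nonneg (by linarith)] at e1 e2
        rw [abs_sub_comm, abs_of_nonneg (by linarith)]
        linarith
      · linarith
      · refine (σ.dist_le (m2 s hs) (m2 t ht)).trans (le_of_eq ?_)
        congr 1; ring
    have hψK : ∀ s ∈ Icc 0 (σ.len - (q - p)), ψ s ∈ γ.image := by
      intro s hs
      simp only [ψ]
      split_ifs with a
      · exact hσK ⟨s, ⟨hs.1, a.trans hp.2⟩, rfl⟩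
      · exact hσK ⟨_, ⟨by linarith [hs.1], by linarith [hs.2]⟩, rfl⟩
    have h2 := adm_of_lip hl ψ hlip hψK
    rw [hψ0, hψ1] at h2
    have := hmin _ _ hl h2
    linarith
  intro p hp q hq he
  rcases lt_trichotomy p q with h | h | h
  · exact absurd he (key p hp q hq h)
  · exact h
  · exact absurd he.symm (key q hq p hp h)


/-- the endpoints of `γ` are on different sides of level `t`. -/
def CrossC {X : Type*} [MetricSpace X] (v : X → ℝ) (t : ℝ) (γ : MCurve X) : Prop :=
  ¬ (v (γ.toFun 0) ≤ t ↔ v (γ.toFun γ.len) ≤ t)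

/-- the crossing set of level `t`. -/
def SS {X : Type*} [MetricSpace X] (v : X → ℝ) (t : ℝ) : Set X :=
  {x | ∀ ρ > 0, ∃ γ : MCurve X, γ.IsSimple ∧ γ.image ⊆ Metric.ball x ρ ∧ CrossC v t γ}

/-- levels whose crossing set meets `A`. -/
def TT {X : Type*} [MetricSpace X] (v : X → ℝ) (A : Set X) : Set ℝ := {t | (SS v t ∩ A).Nonempty}

lemma TT_mono {X : Type*} [MetricSpace X] (v : X → ℝ) {A B : Set X} (h : A ⊆ B) :
    TT v A ⊆ TT v B := fun _ ⟨x, hx, hA⟩ => ⟨x, hx, h hA⟩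

lemma cross_hit {X : Type*} [MetricSpace X] {v : X → ℝ} {t : ℝ} {γ : MCurve X}
    (h : CrossC v t γ) : ∃ s ∈ Icc 0 γ.len, γ.toFun s ∈ SS v t := by
  by_contra hcon
  push Not at hcon
  apply h
  have hz : (0:ℝ) ∈ Icc 0 γ.len := ⟨le_rfl, γ.len_nonneg⟩
  have hl : γ.len ∈ Icc 0 γ.len := ⟨γ.len_nonneg, le_rfl⟩
  haveI : PreconnectedSpace (Icc 0 γ.len) := Subtype.preconnectedSpace isPreconnected_Icc
  let F : Icc 0 γ.len → Prop := fun s => v (γ.toFun s) ≤ t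
  have hF : IsLocallyConstant F := by
    rw [IsLocallyConstant.iff_eventually_eq]
    intro s
    have h1 := hcon s s.2
    simp only [SS, mem_ofPred_eq] at h1
    push Not at h1
    obtain ⟨ρ, hρ, h1⟩ := h1
    have key : ∀ p q : ℝ, p ∈ Icc 0 γ.len → q ∈ Icc 0 γ.len → p ≤ q → (s:ℝ) ∈ Icc p q →
        q - p < ρ → (v (γ.toFun p) ≤ t ↔ v (γ.toFun q) ≤ t) := by
      intro p q hp hq hpq hs hlt
      obtain ⟨σ, hσ, hσ0, hσ1, hσi⟩ := (γ.sub p q hp.1 hpq hq.2).exists_simple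
      have h2 := h1 σ hσ (by
        refine hσi.trans ?_
        rw [MCurve.sub_image]
        rintro _ ⟨r, hr, rfl⟩
        rw [Metric.mem_ball]
        refine (γ.dist_le ⟨hp.1.trans hr.1, hr.2.trans hq.2⟩ s.2).trans_lt ?_
        rw [abs_lt]; constructor <;> linarith [hr.1, hr.2, hs.1, hs.2])
      unfold CrossC at h2
      push Not at h2
      rw [hσ0, hσ1] at h2
      simpa [MCurve.sub] using h2
    filter_upwards [Metric.ball_mem_nhds s hρ] with y hy
    rw [Metric.mem_ball, Subtype.dist_eq, Real.dist_eq, abs_lt] at hy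
    apply propext
    rcases le_total (s:ℝ) y with hsy | hsy
    · exact (key s y s.2 y.2 hsy ⟨le_rfl, hsy⟩ (by linarith)).symm
    · exact (key y s y.2 s.2 hsy ⟨hsy, le_rfl⟩ (by linarith))
  have := hF.apply_eq_of_preconnectedSpace ⟨0, hz⟩ ⟨γ.len, hl⟩
  exact iff_of_eq this

lemma tsum_le_pVar {X : Type*} [MetricSpace X] (v : X → ℝ) {κ : Type*} (γ : κ → MCurve X)
    (hs : ∀ k, (γ k).IsSimple) (hd : ∀ i j, i ≠ j → Disjoint (γ i).image (γ j).image) :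
    ∑' k, ENNReal.ofReal |v ((γ k).toFun (γ k).len) - v ((γ k).toFun 0)| ≤ pVar v := by
  rw [ENNReal.tsum_eq_iSup_sum]
  refine iSup_le fun s => ?_
  let e := s.equivFin
  have : ∑ k ∈ s, ENNReal.ofReal |v ((γ k).toFun (γ k).len) - v ((γ k).toFun 0)|
      = ∑ i : Fin s.card, ENNReal.ofReal |v ((γ (e.symm i)).toFun (γ (e.symm i)).len)
        - v ((γ (e.symm i)).toFun 0)| := by
    rw [← Finset.sum_coe_sort]
    exact (Equiv.sum_comp e.symm (fun k : s => ENNReal.ofReal |v ((γ k).toFun (γ k).len) - v ((γ k).toFun 0)|)).symm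
  rw [this]
  unfold pVar
  refine le_iSup_of_le s.card (le_iSup_of_le (fun i => γ (e.symm i)) (le_iSup_of_le (fun i => hs _)
    (le_iSup_of_le (fun i j hij => hd _ _ ?_) le_rfl)))
  intro h
  exact hij (e.symm.injective (Subtype.ext h))

lemma simple_le_pVar {X : Type*} [MetricSpace X] (v : X → ℝ) (γ : MCurve X) (hs : γ.IsSimple) :
    ENNReal.ofReal |v (γ.toFun γ.len) - v (γ.toFun 0)| ≤ pVar v := by
  have := tsum_le_pVar v (fun _ : Unit => γ) (fun _ => hs) (fun i j h => absurd rfl h)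
  simpa using this

lemma good_sub {X : Type*} [MetricSpace X] {v : X → ℝ} {t : ℝ} {σ : MCurve X} {τ : ℝ}
    (hv : pVar v < ⊤) (hτ : 1 < τ) (hσ : σ.IsSimple) (h : CrossC v t σ) :
    ∃ a b : ℝ, ∃ η : MCurve X, a < b ∧ t ∈ Icc a b ∧ b - a ≤ τ * (pVar v).toReal ∧
      (∀ x ∈ σ.image, v x ∈ Icc a b) ∧ η.IsSimple ∧ η.image ⊆ σ.image ∧
      b - a ≤ τ * |v (η.toFun η.len) - v (η.toFun 0)| := by
  have hsub : ∀ x ∈ σ.image, ∀ y ∈ σ.image, ∃ η : MCurve X, η.IsSimple ∧ η.image ⊆ σ.image ∧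
      |v (η.toFun η.len) - v (η.toFun 0)| = |v x - v y| := by
    have key : ∀ p ∈ Icc 0 σ.len, ∀ q ∈ Icc 0 σ.len, p ≤ q →
        ∃ η : MCurve X, η.IsSimple ∧ η.image ⊆ σ.image ∧
        |v (η.toFun η.len) - v (η.toFun 0)| = |v (σ.toFun q) - v (σ.toFun p)| := by
      intro p hp q hq hpq
      refine ⟨σ.sub p q hp.1 hpq hq.2, σ.sub_simple _ _ _ _ _ hσ, ?_, ?_⟩
      · rw [MCurve.sub_image]
        exact image_mono (Icc_subset_Icc hp.1 hq.2)
      · simp [MCurve.sub]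
    rintro _ ⟨p, hp, rfl⟩ _ ⟨q, hq, rfl⟩
    rcases le_total p q with hpq | hpq
    · rw [abs_sub_comm (v (σ.toFun p))]; exact key p hp q hq hpq
    · exact key q hq p hp hpq
  have hM : ∀ x ∈ σ.image, ∀ y ∈ σ.image, |v x - v y| ≤ (pVar v).toReal := by
    intro x hx y hy
    obtain ⟨η, h1, _, h3⟩ := hsub x hx y hy
    rw [← h3]
    have := ENNReal.toReal_mono hv.ne (simple_le_pVar v η h1)
    rwa [ENNReal.toReal_ofReal (abs_nonneg _)] at this
  have h0 : σ.toFun 0 ∈ σ.image := ⟨0, ⟨le_rfl, σ.len_nonneg⟩, rfl⟩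
  have hl : σ.toFun σ.len ∈ σ.image := ⟨_, ⟨σ.len_nonneg, le_rfl⟩, rfl⟩
  set V := v '' σ.image with hV
  have hVn : V.Nonempty := ⟨_, mem_image_of_mem v h0⟩
  have hba : BddAbove V := by
    refine ⟨v (σ.toFun 0) + (pVar v).toReal, ?_⟩
    rintro _ ⟨x, hx, rfl⟩
    linarith [(abs_le.1 (hM x hx _ h0)).2]
  have hbb : BddBelow V := by
    refine ⟨v (σ.toFun 0) - (pVar v).toReal, ?_⟩
    rintro _ ⟨x, hx, rfl⟩
    linarith [(abs_le.1 (hM x hx _ h0)).1]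
  have hin : ∀ x ∈ σ.image, v x ∈ Icc (sInf V) (sSup V) := fun x hx =>
    ⟨csInf_le hbb (mem_image_of_mem v hx), le_csSup hba (mem_image_of_mem v hx)⟩
  have hcr : sInf V < sSup V ∧ t ∈ Icc (sInf V) (sSup V) := by
    have e1 := hin _ h0
    have e2 := hin _ hl
    unfold CrossC at h
    by_cases c1 : v (σ.toFun 0) ≤ t
    · have c2 : ¬ v (σ.toFun σ.len) ≤ t := fun c2 => h ⟨fun _ => c2, fun _ => c1⟩
      push Not at c2
      exact ⟨by linarith [e1.1, e2.2], by linarith [e1.1], by linarith [e2.2]⟩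
    · have c2 : v (σ.toFun σ.len) ≤ t := by
        by_contra c2
        exact h ⟨fun c => absurd c c1, fun c => absurd c c2⟩
      push Not at c1
      exact ⟨by linarith [e2.1, e1.2], by linarith [e2.1], by linarith [e1.2]⟩
  set d := sSup V - sInf V with hd
  have hdp : 0 < d := by linarith [hcr.1]
  have hτi : d / τ < d := div_lt_self hdp hτ
  obtain ⟨_, ⟨x, hx, rfl⟩, hx2⟩ := exists_lt_of_lt_csSup hVn
    (show sSup V - (d - d / τ) / 2 < sSup V by linarith)
  obtain ⟨_, ⟨y, hy, rfl⟩, hy2⟩ := exists_lt_of_csInf_lt hVn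
    (show sInf V < sInf V + (d - d / τ) / 2 by linarith)
  obtain ⟨η, g1, g2, g3⟩ := hsub x hx y hy
  have hfin : d ≤ τ * |v x - v y| := by
    have : d / τ ≤ |v x - v y| := le_trans (by linarith) (le_abs_self _)
    rwa [div_le_iff₀' (by linarith)] at this
  refine ⟨sInf V, sSup V, η, hcr.1, hcr.2, ?_, hin, g1, g2, by rw [g3]; exact hfin⟩
  exact hfin.trans (mul_le_mul_of_nonneg_left (hM x hx y hy) (by linarith))

lemma lemV {X : Type*} [MetricSpace X] {v : X → ℝ} {τ : ℝ}
    (hv : pVar v < ⊤) (hτ : 1 < τ) {U : Set X} (hU : IsOpen U) :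
    ∃ (κ : Type) (γ : κ → MCurve X), (∀ k, (γ k).IsSimple) ∧
      (∀ i j, i ≠ j → Disjoint (γ i).image (γ j).image) ∧ (∀ k, (γ k).image ⊆ U) ∧
      volume (TT v U) ≤ ENNReal.ofReal ((1 + 2 * τ) * τ) *
        ∑' k, ENNReal.ofReal |v ((γ k).toFun (γ k).len) - v ((γ k).toFun 0)| := by
  have h1 : ∀ t : TT v U, ∃ σ : MCurve X, σ.IsSimple ∧ σ.image ⊆ U ∧ CrossC v t σ := by
    rintro ⟨t, x, hx, hxU⟩
    obtain ⟨ρ, hρ, hb⟩ := Metric.isOpen_iff.1 hU x hxU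
    obtain ⟨γ, g1, g2, g3⟩ := hx ρ hρ
    exact ⟨γ, g1, g2.trans hb, g3⟩
  choose σ hσ hσU hσc using h1
  choose a b η hab ht hM hin hη hησ hlen using fun t => good_sub hv hτ (hσ t) (hσc t)
  obtain ⟨u, -, hud, hu⟩ := Vitali.exists_disjoint_subfamily_covering_enlargement
    (fun t : TT v U => Icc (a t) (b t)) univ (fun t => b t - a t) τ hτ
    (fun t _ => by linarith [hab t]) (τ * (pVar v).toReal) (fun t _ => hM t)
    (fun t _ => ⟨_, ht t⟩)
  have hc : u.Countable := hud.countable_of_nonempty_interior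
    (fun t _ => by rw [interior_Icc]; exact nonempty_Ioo.2 (hab t))
  refine ⟨u, fun k => η k, fun k => hη k, ?_, fun k => (hησ k).trans (hσU k), ?_⟩
  · intro i j hij
    have hd := hud i.2 j.2 (fun h => hij (Subtype.ext h))
    rw [Function.onFun] at hd
    rw [Set.disjoint_left] at hd ⊢
    intro x hx hx'
    exact hd (hin _ x (hησ _ hx)) (hin _ x (hησ _ hx'))
  · haveI := hc.to_subtype
    have hsub : TT v U ⊆ ⋃ k : u, Icc (a k - τ * (b k - a k)) (b k + τ * (b k - a k)) := by
      intro t htU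
      obtain ⟨k, hk, ⟨z, hz1, hz2⟩, hd⟩ := hu ⟨t, htU⟩ trivial
      refine mem_iUnion.2 ⟨⟨k, hk⟩, ?_⟩
      have := ht ⟨t, htU⟩
      constructor
      · linarith [this.1, this.2, hz1.1, hz1.2, hz2.1, hz2.2]
      · linarith [this.1, this.2, hz1.1, hz1.2, hz2.1, hz2.2]
    refine (measure_mono hsub).trans ((measure_iUnion_le _).trans ?_)
    rw [← ENNReal.tsum_mul_left]
    refine ENNReal.tsum_le_tsum fun k => ?_
    rw [Real.volume_Icc, ← ENNReal.ofReal_mul (by nlinarith)]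
    apply ENNReal.ofReal_le_ofReal
    have := hlen k
    nlinarith

lemma lemW {X : Type*} [MetricSpace X] {v : X → ℝ} {τ : ℝ}
    (hv : pVar v < ⊤) (hτ : 1 < τ) {ι : Type*} (U : ι → Set X) (hU : ∀ i, IsOpen (U i))
    (hd : ∀ i j, i ≠ j → Disjoint (U i) (U j)) :
    ∑' i, volume (TT v (U i)) ≤ ENNReal.ofReal ((1 + 2 * τ) * τ) * pVar v := by
  choose κ γ hs hdd hγU hvol using fun i => lemV hv hτ (hU i)
  refine (ENNReal.tsum_le_tsum hvol).trans ?_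
  rw [ENNReal.tsum_mul_left]
  gcongr
  rw [← ENNReal.tsum_sigma]
  refine tsum_le_pVar v (fun p : (Σ i, κ i) => γ p.1 p.2) (fun p => hs _ _) ?_
  rintro ⟨i, k⟩ ⟨j, l⟩ hne
  by_cases hij : i = j
  · subst hij
    exact hdd i k l (fun h => hne (by rw [h]))
  · exact (hd i j hij).mono (hγU i k) (hγU j l)

lemma exists_radius {X : Type*} [MetricSpace X] {v : X → ℝ}
    (hv : pVar v < ⊤) (x : X) {a b : ℝ} (hab : a < b) :
    ∃ r ∈ Ioo a b, volume (TT v (Metric.sphere x r)) = 0 := by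
  by_contra hcon
  push Not at hcon
  have h1 : ∑' r : Ioo a b, volume (TT v (Metric.sphere x r))
      ≤ ENNReal.ofReal ((1 + 2 * 2) * 2) * pVar v := by
    rw [ENNReal.tsum_eq_iSup_sum]
    refine iSup_le fun s => ?_
    obtain ⟨W, hW, hWd⟩ := (s.finite_toSet).t2_separation
    have h2 := lemW hv (τ := 2) (by norm_num) (fun r : s => {y | (∃ hy : dist y x ∈ Ioo a b, (⟨_, hy⟩ : Ioo a b) ∈ W r)})
      ?_ ?_
    · rw [tsum_fintype] at h2
      rw [← Finset.sum_coe_sort]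
      refine le_trans (Finset.sum_le_sum fun r _ => measure_mono (TT_mono v ?_)) h2
      intro y hy
      rw [Metric.mem_sphere] at hy
      exact ⟨by rw [hy]; exact r.1.2, by simpa [hy] using (hW r).1⟩
    · intro r
      obtain ⟨O, hO, hOW⟩ := isOpen_induced_iff.1 (hW r).2
      have : {y | (∃ hy : dist y x ∈ Ioo a b, (⟨_, hy⟩ : Ioo a b) ∈ W r)}
          = (fun y => dist y x) ⁻¹' (Ioo a b ∩ O) := by
        ext y
        simp only [mem_ofPred_eq, ← hOW, mem_preimage, mem_inter_iff, exists_prop]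
      rw [this]
      exact (isOpen_Ioo.inter hO).preimage (by fun_prop)
    · intro i j hij
      have hdis := hWd i.2 j.2 (fun h => hij (Subtype.ext h))
      rw [Function.onFun, Set.disjoint_left] at hdis
      rw [Set.disjoint_left]
      rintro y ⟨hy, hy1⟩ ⟨_, hy2⟩
      exact hdis hy1 hy2
  have h2 : ∑' r : Ioo a b, volume (TT v (Metric.sphere x r)) ≠ ⊤ :=
    (h1.trans_lt (ENNReal.mul_lt_top ENNReal.ofReal_lt_top hv)).ne
  have h3 := Summable.countable_support_ennreal h2
  have h4 : (Function.support fun r : Ioo a b => volume (TT v (Metric.sphere x r))) = univ := by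
    ext r; simp only [Function.mem_support, mem_univ, iff_true]; exact hcon r r.2
  rw [h4, Set.countable_univ_iff] at h3
  have h5 := (Set.countable_coe_iff.1 h3).measure_zero volume
  rw [Real.volume_Ioo, ENNReal.ofReal_eq_zero] at h5
  linarith


lemma exists_cover {X : Type*} [MetricSpace X] [Nonempty X] [MeasurableSpace X] [BorelSpace X]
    (h1 : μH[1] (Set.univ : Set X) < ⊤) {δ : ℝ} (hδ : 0 < δ) :
    ∃ c : ℕ → X, ∀ x, ∃ k, dist x (c k) ≤ δ := by
  rw [Measure.hausdorffMeasure_apply] at h1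
  have h2 := (le_iSup₂ (f := fun (r : ℝ≥0∞) (_ : 0 < r) =>
        ⨅ (t : ℕ → Set X) (_ : univ ⊆ ⋃ n, t n) (_ : ∀ n, Metric.ediam (t n) ≤ r),
          ∑' n, ⨆ _ : (t n).Nonempty, Metric.ediam (t n) ^ (1:ℝ)) (ENNReal.ofReal δ) (by simpa using hδ)).trans_lt h1
  simp only [iInf_lt_iff] at h2
  obtain ⟨t, ht, htd, -⟩ := h2
  classical
  refine ⟨fun k => if h : (t k).Nonempty then h.some else Classical.arbitrary X, fun x => ?_⟩
  obtain ⟨k, hk⟩ := mem_iUnion.1 (ht (mem_univ x))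
  refine ⟨k, ?_⟩
  have hne : (t k).Nonempty := ⟨x, hk⟩
  simp only [dif_pos hne]
  have := (Metric.edist_le_ediam_of_mem hk hne.some_mem).trans (htd k)
  rw [edist_dist] at this
  exact (ENNReal.ofReal_le_ofReal_iff hδ.le).1 this

/-- One scale. -/
lemma one_scale {X : Type*} [MetricSpace X] [Nonempty X] [MeasurableSpace X] [BorelSpace X]
    (h1 : μH[1] (Set.univ : Set X) < ⊤) {v : X → ℝ} {τ : ℝ}
    (hv : pVar v < ⊤) (hτ : 1 < τ) {δ : ℝ} (hδ : 0 < δ) :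
    ∃ N : ℝ → ℝ≥0∞, Measurable N ∧
      ∫⁻ t, N t ≤ ENNReal.ofReal ((1 + 2 * τ) * τ) * pVar v ∧
      ∀ᵐ t, ∀ P : Finset X, (↑P : Set X) ⊆ SS v t →
        (∀ p ∈ P, ∀ q ∈ P, p ≠ q → 4 * δ ≤ dist p q) → (P.card : ℝ≥0∞) ≤ N t := by
  obtain ⟨c, hc⟩ := exists_cover h1 hδ
  choose r hr hr0 using fun k => exists_radius hv (c k) (show δ < 2 * δ by linarith)
  let U : ℕ → Set X := fun k => Metric.ball (c k) (r k) \ ⋃ i ∈ Finset.range k, Metric.closedBall (c i) (r i)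
  have hUo : ∀ k, IsOpen (U k) := fun k => Metric.isOpen_ball.sdiff
    (isClosed_biUnion_finset fun i _ => Metric.isClosed_closedBall)
  have hUd' : ∀ i j, i < j → Disjoint (U i) (U j) := by
    intro i j hij
    rw [Set.disjoint_left]
    intro x hx hx'
    exact hx'.2 (mem_iUnion₂.2 ⟨i, Finset.mem_range.2 hij, Metric.ball_subset_closedBall hx.1⟩)
  have hUd : ∀ i j, i ≠ j → Disjoint (U i) (U j) := by
    intro i j hij
    rcases lt_or_gt_of_ne hij with h | h
    · exact hUd' i j h
    · exact (hUd' j i h).symm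
  let N : ℝ → ℝ≥0∞ := fun t => ∑' k, (toMeasurable volume (TT v (U k))).indicator 1 t
  have hm : ∀ k, Measurable ((toMeasurable volume (TT v (U k))).indicator (1 : ℝ → ℝ≥0∞)) :=
    fun k => measurable_one.indicator (measurableSet_toMeasurable _ _)
  refine ⟨N, Measurable.tsum hm, ?_, ?_⟩
  · rw [lintegral_tsum (fun k => (hm k).aemeasurable)]
    refine le_trans (le_of_eq ?_) (lemW hv hτ U hUo hUd)
    congr 1; ext k
    rw [lintegral_indicator_one (measurableSet_toMeasurable _ _), measure_toMeasurable]
  · have hnull : ∀ᵐ t, ∀ k, t ∉ TT v (Metric.sphere (c k) (r k)) := by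
      rw [ae_all_iff]
      intro k
      exact measure_eq_zero_iff_ae_notMem.1 (hr0 k)
    filter_upwards [hnull] with t ht P hP hPd
    have hk : ∀ p ∈ P, ∃ k, p ∈ U k := by
      intro p hp
      classical
      have hex : ∃ k, p ∈ Metric.closedBall (c k) (r k) := by
        obtain ⟨k, hk⟩ := hc p
        exact ⟨k, by rw [Metric.mem_closedBall]; linarith [(hr k).1]⟩
      refine ⟨Nat.find hex, ?_, ?_⟩
      · have h2 := Nat.find_spec hex
        rw [Metric.mem_closedBall] at h2
        rw [Metric.mem_ball]
        refine lt_of_le_of_ne h2 (fun h3 => ht (Nat.find hex) ⟨p, hP hp, h3⟩)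
      · intro h2
        obtain ⟨i, hi, hpi⟩ := mem_iUnion₂.1 h2
        exact Nat.find_min hex (Finset.mem_range.1 hi) hpi
    choose! k hk using hk
    have hinj : Set.InjOn k P := by
      intro p hp q hq hpq
      by_contra hne
      have e := hPd p hp q hq hne
      have e1 := (hk p hp).1
      have e2 := (hk q hq).1
      rw [← hpq] at e2
      rw [Metric.mem_ball] at e1 e2
      have := dist_triangle_right p q (c (k p))
      linarith [(hr (k p)).2]
    classical
    calc (P.card : ℝ≥0∞) = ((P.image k).card : ℝ≥0∞) := by rw [Finset.card_image_of_injOn hinj]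
      _ = ∑ j ∈ P.image k, 1 := by simp
      _ ≤ ∑ j ∈ P.image k, (toMeasurable volume (TT v (U j))).indicator 1 t := by
        refine Finset.sum_le_sum fun j hj => ?_
        obtain ⟨p, hp, rfl⟩ := Finset.mem_image.1 hj
        rw [indicator_of_mem]
        · rfl
        · exact subset_toMeasurable _ _ ⟨p, hP hp, hk p hp⟩
      _ ≤ N t := ENNReal.sum_le_tsum _

lemma propN {X : Type*} [MetricSpace X] [Nonempty X] [MeasurableSpace X] [BorelSpace X]
    (h1 : μH[1] (Set.univ : Set X) < ⊤) {v : X → ℝ} {τ : ℝ}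
    (hv : pVar v < ⊤) (hτ : 1 < τ) :
    ∃ N : ℝ → ℝ≥0∞, Measurable N ∧
      ∫⁻ t, N t ≤ ENNReal.ofReal ((1 + 2 * τ) * τ) * pVar v ∧
      ∀ᵐ t, ∀ P : Finset X, (↑P : Set X) ⊆ SS v t → (P.card : ℝ≥0∞) ≤ N t := by
  choose N hNm hNi hN using fun n : ℕ => one_scale h1 hv hτ (δ := 1 / ((n:ℝ) + 1)) (by positivity)
  refine ⟨fun t => liminf (fun n => N n t) atTop, Measurable.liminf hNm, ?_, ?_⟩
  · refine (lintegral_liminf_le hNm).trans ?_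
    exact (liminf_le_liminf (Eventually.of_forall hNi)).trans (by simp)
  · rw [← ae_all_iff] at hN
    filter_upwards [hN] with t ht P hP
    have hsep : ∃ d > 0, ∀ p ∈ P, ∀ q ∈ P, p ≠ q → d ≤ dist p q := by
      classical
      by_cases hne : (P.offDiag).Nonempty
      · obtain ⟨m, hm, hmin⟩ := P.offDiag.exists_min_image (fun x => dist x.1 x.2) hne
        rw [Finset.mem_offDiag] at hm
        refine ⟨dist m.1 m.2, dist_pos.2 hm.2.2, fun p hp q hq hpq => ?_⟩
        exact hmin (p, q) (Finset.mem_offDiag.2 ⟨hp, hq, hpq⟩)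
      · refine ⟨1, one_pos, fun p hp q hq hpq => ?_⟩
        exact absurd ⟨(p, q), Finset.mem_offDiag.2 ⟨hp, hq, hpq⟩⟩ hne
    obtain ⟨d, hd, hsep⟩ := hsep
    refine le_liminf_of_le (by isBoundedDefault) ?_
    have hlim : Tendsto (fun n : ℕ => 4 * (1 / ((n:ℝ) + 1))) atTop (𝓝 0) := by
      simpa using (tendsto_one_div_add_atTop_nhds_zero_nat (𝕜 := ℝ)).const_mul 4
    filter_upwards [hlim.eventually (gt_mem_nhds hd)] with n hn
    exact ht n P hP (fun p hp q hq hpq => hn.le.trans (hsep p hp q hq hpq))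

/-- choice of levels -/
lemma levels {X : Type*} [MetricSpace X] [Nonempty X] [MeasurableSpace X] [BorelSpace X]
    (h1 : μH[1] (Set.univ : Set X) < ⊤) {v : X → ℝ} {τ : ℝ}
    (hv : pVar v < ⊤) (hτ : 1 < τ) {h : ℝ} (hh : 0 < h) :
    ∃ t : ℤ → ℝ, ∃ P : ℤ → Finset X, ∃ I : Finset ℤ, (∀ i : ℤ, t i ∈ Ioc ((i:ℝ) * h) (((i:ℝ) + 1) * h)) ∧
      (∀ i, SS v (t i) = (P i : Set X)) ∧ (∀ i ∉ I, P i = ∅) ∧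
      ∑ i ∈ I, ENNReal.ofReal h * (P i).card ≤ ENNReal.ofReal ((1 + 2 * τ) * τ) * pVar v := by
  obtain ⟨N, hNm, hNi, hN⟩ := propN h1 hv hτ
  have htop : ENNReal.ofReal ((1 + 2 * τ) * τ) * pVar v < ⊤ :=
    ENNReal.mul_lt_top ENNReal.ofReal_lt_top hv
  have hsum : ∑' i : ℤ, ∫⁻ t in Ioc ((i:ℝ) * h) (((i:ℝ) + 1) * h), N t = ∫⁻ t, N t := by
    have e1 : ⋃ n : ℤ, Ioc ((n:ℝ) * h) ((n + 1) * h) = univ := by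
      have := iUnion_Ioc_zsmul hh
      simpa using this
    have e2 : Pairwise (Function.onFun Disjoint fun n : ℤ => Ioc ((n:ℝ) * h) ((n + 1) * h)) := by
      have := pairwise_disjoint_Ioc_zsmul h
      simpa using this
    rw [← lintegral_iUnion (fun i => measurableSet_Ioc) e2, e1, setLIntegral_univ]
  have hch : ∀ i : ℤ, ∃ t ∈ Ioc ((i:ℝ) * h) (((i:ℝ) + 1) * h),
      (∀ P : Finset X, (↑P : Set X) ⊆ SS v t → (P.card : ℝ≥0∞) ≤ N t) ∧
      ENNReal.ofReal h * N t ≤ ∫⁻ t in Ioc ((i:ℝ) * h) (((i:ℝ) + 1) * h), N t := by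
    intro i
    have hvol : volume (Ioc ((i:ℝ) * h) ((i + 1) * h)) = ENNReal.ofReal h := by
      rw [Real.volume_Ioc]; congr 1; ring
    have hne : volume.restrict (Ioc ((i:ℝ) * h) ((i + 1) * h)) ≠ 0 := by
      rw [Ne, Measure.restrict_eq_zero, hvol]; simpa using hh
    have hb : ∀ᵐ t ∂volume.restrict (Ioc ((i:ℝ) * h) ((i + 1) * h)), t ∈ Ioc ((i:ℝ) * h) ((i + 1) * h) ∧
      (∀ P : Finset X, (↑P : Set X) ⊆ SS v t → (P.card : ℝ≥0∞) ≤ N t) :=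
      (ae_restrict_mem measurableSet_Ioc).and (ae_restrict_of_ae hN)
    obtain ⟨t, ht, htl⟩ := exists_notMem_null_le_laverage hne hNm.aemeasurable (ae_iff.1 hb)
    simp only [mem_ofPred_eq, not_not] at ht
    refine ⟨t, ht.1, ht.2, ?_⟩
    rw [setLAverage_eq, hvol] at htl
    rw [mul_comm]
    exact (ENNReal.le_div_iff_mul_le (Or.inl (by simpa using hh)) (Or.inl ENNReal.ofReal_ne_top)).1 htl
  choose t ht htP htN using hch
  have hsum2 : ∑' i, ENNReal.ofReal h * N (t i) ≤ ENNReal.ofReal ((1 + 2 * τ) * τ) * pVar v :=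
    (ENNReal.tsum_le_tsum htN).trans (hsum.le.trans hNi)
  have hNfin : ∀ i, N (t i) < ⊤ := by
    intro i
    have := (ENNReal.le_tsum i).trans_lt (hsum2.trans_lt htop)
    by_contra hc
    rw [not_lt, top_le_iff] at hc
    rw [hc, ENNReal.mul_top (by simpa using hh)] at this
    exact lt_irrefl _ this
  have hfin : ∀ i, (SS v (t i)).Finite := by
    intro i
    by_contra hinf
    obtain ⟨n, hn⟩ := ENNReal.exists_nat_gt (hNfin i).ne
    obtain ⟨P, hP, hPc⟩ := Set.Infinite.exists_subset_card_eq hinf n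
    have := htP i P hP
    rw [hPc] at this
    exact absurd hn (not_lt.2 this)
  have hcard : ∀ i, ((hfin i).toFinset.card : ℝ≥0∞) ≤ N (t i) := fun i => htP i _ (by simp)
  have hI := ENNReal.finite_const_le_of_tsum_ne_top (hsum2.trans_lt htop).ne
    (ε := ENNReal.ofReal h) (by simpa using hh)
  refine ⟨t, fun i => (hfin i).toFinset, hI.toFinset, ht, by simp, ?_, ?_⟩
  · intro i hi
    by_contra hne
    apply hi
    rw [Set.Finite.mem_toFinset, mem_ofPred_eq]
    have : 1 ≤ ((hfin i).toFinset.card : ℝ≥0∞) := by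
      exact_mod_cast Finset.card_pos.2 (Finset.nonempty_iff_ne_empty.2 hne)
    calc ENNReal.ofReal h = ENNReal.ofReal h * 1 := by simp
      _ ≤ _ := by gcongr; exact this.trans (hcard i)
  · refine le_trans ?_ hsum2
    refine le_trans ?_ (ENNReal.sum_le_tsum hI.toFinset)
    gcongr with i hi
    exact hcard i


/-- cutoff at a point -/
noncomputable def etaP {X : Type*} [MetricSpace X] (ρ : X → ℝ) (p x : X) : ℝ :=
  min 1 (dist x p / ρ p)

/-- gradient of the cutoff -/
noncomputable def gP {X : Type*} [MetricSpace X] (ρ : X → ℝ) (p : X) : X → ℝ≥0∞ :=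
  (Metric.ball p (ρ p)).indicator (fun _ => (ENNReal.ofReal (ρ p))⁻¹)

lemma etaP_nonneg {X : Type*} [MetricSpace X] {ρ : X → ℝ} (hρ : ∀ p, 0 < ρ p) (p x : X) :
    0 ≤ etaP ρ p x := le_min zero_le_one (div_nonneg dist_nonneg (hρ p).le)

lemma etaP_le {X : Type*} [MetricSpace X] (ρ : X → ℝ) (p x : X) :
    etaP ρ p x ≤ 1 := min_le_left _ _

lemma etaP_self {X : Type*} [MetricSpace X] (ρ : X → ℝ) (p : X) :
    etaP ρ p p = 0 := by simp [etaP]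

lemma etaP_lt {X : Type*} [MetricSpace X] {ρ : X → ℝ} (hρ : ∀ p, 0 < ρ p) {p x : X}
    (h : etaP ρ p x < 1) : x ∈ Metric.ball p (ρ p) := by
  rw [Metric.mem_ball]
  rcases min_lt_iff.1 h with h | h
  · exact absurd h (lt_irrefl _)
  · exact (div_lt_one (hρ p)).1 h

lemma etaP_lip {X : Type*} [MetricSpace X] {ρ : X → ℝ} (hρ : ∀ p, 0 < ρ p) (p x y : X) :
    etaP ρ p x - etaP ρ p y ≤ dist x y / ρ p := by
  have h1 : dist x p ≤ dist x y + dist y p := dist_triangle _ _ _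
  have h2 : dist x p / ρ p ≤ dist x y / ρ p + dist y p / ρ p := by
    rw [← add_div]; exact div_le_div_of_nonneg_right h1 (hρ p).le
  have h3 : 0 ≤ dist x y / ρ p := div_nonneg dist_nonneg (hρ p).le
  unfold etaP
  rcases min_choice 1 (dist y p / ρ p) with h | h <;> rw [h]
  · linarith [min_le_left 1 (dist x p / ρ p)]
  · linarith [min_le_right 1 (dist x p / ρ p)]

lemma etaP_cont {X : Type*} [MetricSpace X] (ρ : X → ℝ) (p : X) : Continuous (etaP ρ p) := by
  unfold etaP; fun_prop

lemma interval_le {X : Type*} [MetricSpace X] {ρ : X → ℝ} (hρ : ∀ p, 0 < ρ p) (p : X)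
    (γ : MCurve X) {c d : ℝ} (hc : 0 ≤ c) (hd : d ≤ γ.len)
    (hin : ∀ s ∈ Ioo c d, γ.toFun s ∈ Metric.ball p (ρ p)) :
    ENNReal.ofReal ((d - c) / ρ p) ≤ ∫⁻ s in Icc 0 γ.len, gP ρ p (γ.toFun s) := by
  calc ENNReal.ofReal ((d - c) / ρ p) = ∫⁻ s in Ioo c d, (ENNReal.ofReal (ρ p))⁻¹ := by
        rw [setLIntegral_const, Real.volume_Ioo, ENNReal.ofReal_div_of_pos (hρ p), mul_comm]
        rfl
    _ = ∫⁻ s in Ioo c d, gP ρ p (γ.toFun s) := by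
        refine setLIntegral_congr_fun measurableSet_Ioo (fun s hs => ?_)
        simp only [gP, indicator_of_mem (hin s hs)]
    _ ≤ _ := lintegral_mono_set (show Ioo c d ⊆ Icc 0 γ.len from
        fun s hs => ⟨hc.trans hs.1.le, hs.2.le.trans hd⟩)

lemma etaP_curve {X : Type*} [MetricSpace X] {ρ : X → ℝ} (hρ : ∀ p, 0 < ρ p) (p : X)
    (γ : MCurve X) {a b : ℝ} (ha : a ∈ Icc 0 γ.len) (hb : b ∈ Icc 0 γ.len) :
    ENNReal.ofReal |etaP ρ p (γ.toFun a) - etaP ρ p (γ.toFun b)|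
      ≤ ∫⁻ s in Icc 0 γ.len, gP ρ p (γ.toFun s) := by
  wlog hab : etaP ρ p (γ.toFun a) ≤ etaP ρ p (γ.toFun b) generalizing a b
  · rw [abs_sub_comm]; exact this hb ha (le_of_not_ge hab)
  have hcont : ContinuousOn (fun s => etaP ρ p (γ.toFun s)) (Icc 0 γ.len) :=
    (etaP_cont ρ p).comp_continuousOn γ.continuousOn
  rw [abs_sub_comm, abs_of_nonneg (sub_nonneg.2 hab)]
  have key : ∀ c d, c ≤ d → Icc c d ⊆ Icc 0 γ.len →
      IsCompact {s ∈ Icc c d | etaP ρ p (γ.toFun b) ≤ etaP ρ p (γ.toFun s)} := by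
    intro c d hcd hsub
    have : IsClosed {s ∈ Icc c d | etaP ρ p (γ.toFun b) ≤ etaP ρ p (γ.toFun s)} :=
      isClosed_Icc.isClosed_le continuousOn_const (hcont.mono hsub)
    exact isCompact_Icc.of_isClosed_subset this (fun s hs => hs.1)
  rcases le_total a b with h | h
  · have hsub : Icc a b ⊆ Icc 0 γ.len := Icc_subset_Icc ha.1 hb.2
    obtain ⟨s, hs, hmin⟩ := (key a b h hsub).exists_isLeast ⟨b, ⟨h, le_rfl⟩, le_rfl⟩
    refine le_trans (ENNReal.ofReal_le_ofReal ?_)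
      (interval_le hρ p γ (c := a) (d := s) ha.1 (hs.1.2.trans hb.2) ?_)
    · have := etaP_lip hρ p (γ.toFun s) (γ.toFun a)
      have h2 := γ.dist_le (hsub hs.1) ha
      rw [abs_of_nonneg (sub_nonneg.2 hs.1.1)] at h2
      have h3 : dist (γ.toFun s) (γ.toFun a) / ρ p ≤ (s - a) / ρ p :=
        div_le_div_of_nonneg_right h2 (hρ p).le
      linarith [hs.2]
    · intro r hr
      apply etaP_lt hρ
      by_contra hc
      have : s ≤ r := hmin ⟨⟨hr.1.le, hr.2.le.trans hs.1.2⟩,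
        (etaP_le ρ p _).trans (not_lt.1 hc)⟩
      linarith [hr.2]
  · have hsub : Icc b a ⊆ Icc 0 γ.len := Icc_subset_Icc hb.1 ha.2
    obtain ⟨s, hs, hmax⟩ := (key b a h hsub).exists_isGreatest ⟨b, ⟨le_rfl, h⟩, le_rfl⟩
    refine le_trans (ENNReal.ofReal_le_ofReal ?_)
      (interval_le hρ p γ (c := s) (d := a) (hb.1.trans hs.1.1) ha.2 ?_)
    · have := etaP_lip hρ p (γ.toFun s) (γ.toFun a)
      have h2 := γ.dist_le (hsub hs.1) ha
      rw [abs_sub_comm, abs_of_nonneg (sub_nonneg.2 hs.1.2)] at h2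
      have h3 : dist (γ.toFun s) (γ.toFun a) / ρ p ≤ (a - s) / ρ p :=
        div_le_div_of_nonneg_right h2 (hρ p).le
      linarith [hs.2]
    · intro r hr
      apply etaP_lt hρ
      by_contra hc
      have : r ≤ s := hmax ⟨⟨hs.1.1.trans hr.1.le, hr.2.le⟩,
        (etaP_le ρ p _).trans (not_lt.1 hc)⟩
      linarith [hr.1]

lemma sum_lint_le {α ι : Type*} [MeasurableSpace α] (μ : Measure α) (s : Finset ι)
    (f : ι → α → ℝ≥0∞) : ∑ i ∈ s, ∫⁻ x, f i x ∂μ ≤ ∫⁻ x, ∑ i ∈ s, f i x ∂μ := by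
  classical
  induction s using Finset.induction_on with
  | empty => simp
  | insert a s ha ih =>
    simp only [Finset.sum_insert ha]
    exact (add_le_add le_rfl ih).trans (le_lintegral_add _ _)

/-- product cutoff -/
noncomputable def eta {X : Type*} [MetricSpace X] (ρ : X → ℝ) (P : Finset X) (x : X) : ℝ :=
  ∏ p ∈ P, etaP ρ p x

lemma eta_nonneg {X : Type*} [MetricSpace X] {ρ : X → ℝ} (hρ : ∀ p, 0 < ρ p) (P : Finset X) (x : X) :
    0 ≤ eta ρ P x := Finset.prod_nonneg fun p _ => etaP_nonneg hρ p x

lemma eta_le {X : Type*} [MetricSpace X] {ρ : X → ℝ} (hρ : ∀ p, 0 < ρ p) (P : Finset X) (x : X) :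
    eta ρ P x ≤ 1 := Finset.prod_le_one (fun p _ => etaP_nonneg hρ p x) (fun p _ => etaP_le ρ p x)

lemma eta_zero {X : Type*} [MetricSpace X] (ρ : X → ℝ) {P : Finset X} {x : X} (hx : x ∈ P) :
    eta ρ P x = 0 := Finset.prod_eq_zero hx (etaP_self ρ x)

lemma eta_sub_le {X : Type*} [MetricSpace X] {ρ : X → ℝ} (hρ : ∀ p, 0 < ρ p) (P : Finset X) (x y : X) :
    |eta ρ P x - eta ρ P y| ≤ ∑ p ∈ P, |etaP ρ p x - etaP ρ p y| := by
  classical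
  induction P using Finset.induction_on with
  | empty => simp [eta]
  | insert a s ha ih =>
    have e : ∀ z, eta ρ (insert a s) z = etaP ρ a z * eta ρ s z := fun z => Finset.prod_insert ha
    rw [Finset.sum_insert ha, e, e]
    have : etaP ρ a x * eta ρ s x - etaP ρ a y * eta ρ s y =
      (etaP ρ a x - etaP ρ a y) * eta ρ s x + etaP ρ a y * (eta ρ s x - eta ρ s y) := by ring
    rw [this]
    refine (abs_add_le _ _).trans (add_le_add ?_ ?_)
    · rw [abs_mul, abs_of_nonneg (eta_nonneg hρ s x)]
      exact mul_le_of_le_one_right (abs_nonneg _) (eta_le hρ s x)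
    · rw [abs_mul, abs_of_nonneg (etaP_nonneg hρ a y)]
      exact (mul_le_of_le_one_left (abs_nonneg _) (etaP_le ρ a y)).trans ih

lemma one_sub_eta_le {X : Type*} [MetricSpace X] {ρ : X → ℝ} (hρ : ∀ p, 0 < ρ p) (P : Finset X) (x : X) :
    ENNReal.ofReal (1 - eta ρ P x) ≤ ∑ p ∈ P, (Metric.ball p (ρ p)).indicator 1 x := by
  by_cases h : ∃ p ∈ P, x ∈ Metric.ball p (ρ p)
  · obtain ⟨p, hp, hx⟩ := h
    refine le_trans ?_ (Finset.single_le_sum (f := fun p => (Metric.ball p (ρ p)).indicator (1 : X → ℝ≥0∞) x)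
      (fun _ _ => zero_le) hp)
    simp only [indicator_of_mem hx, Pi.one_apply]
    rw [← ENNReal.ofReal_one]
    exact ENNReal.ofReal_le_ofReal (by linarith [eta_nonneg hρ P x])
  · push Not at h
    have : eta ρ P x = 1 := Finset.prod_eq_one fun p hp => by
      by_contra hc
      exact h p hp (etaP_lt hρ (lt_of_le_of_ne (etaP_le ρ p x) hc))
    simp [this]

lemma eta_curve {X : Type*} [MetricSpace X] {ρ : X → ℝ} (hρ : ∀ p, 0 < ρ p) (P : Finset X)
    (γ : MCurve X) {a b : ℝ} (ha : a ∈ Icc 0 γ.len) (hb : b ∈ Icc 0 γ.len) :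
    ENNReal.ofReal |eta ρ P (γ.toFun a) - eta ρ P (γ.toFun b)|
      ≤ ∫⁻ s in Icc 0 γ.len, ∑ p ∈ P, gP ρ p (γ.toFun s) := by
  refine (ENNReal.ofReal_le_ofReal (eta_sub_le hρ P _ _)).trans ?_
  rw [ENNReal.ofReal_sum_of_nonneg (fun _ _ => abs_nonneg _)]
  exact (Finset.sum_le_sum fun p _ => etaP_curve hρ p γ ha hb).trans
    (sum_lint_le _ P (fun p s => gP ρ p (γ.toFun s)))

/-- single level -/
lemma level_curve {X : Type*} [MetricSpace X] {v : X → ℝ} {t : ℝ} {ρ : X → ℝ} (hρ : ∀ p, 0 < ρ p)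
    {P : Finset X} (hP : SS v t = (P : Set X)) (χ : X → ℝ)
    (h1 : ∀ x, t < v x → χ x = 1) (h2 : ∀ x, ¬ t < v x → χ x = 0) (γ : MCurve X) :
    ENNReal.ofReal |χ (γ.toFun γ.len) * eta ρ P (γ.toFun γ.len) - χ (γ.toFun 0) * eta ρ P (γ.toFun 0)|
      ≤ ∫⁻ s in Icc 0 γ.len, ∑ p ∈ P, gP ρ p (γ.toFun s) := by
  have m0 : (0:ℝ) ∈ Icc 0 γ.len := ⟨le_rfl, γ.len_nonneg⟩
  have m1 : γ.len ∈ Icc 0 γ.len := ⟨γ.len_nonneg, le_rfl⟩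
  have hx : ∀ (a b : ℝ), CrossC v t γ → a ∈ Icc 0 γ.len →
      ENNReal.ofReal |eta ρ P (γ.toFun a)| ≤ ∫⁻ s in Icc 0 γ.len, ∑ p ∈ P, gP ρ p (γ.toFun s) := by
    intro a b hc ha
    obtain ⟨s, hs, hsS⟩ := cross_hit hc
    rw [hP] at hsS
    have := eta_curve hρ P γ ha hs
    rwa [eta_zero ρ (Finset.mem_coe.1 hsS), sub_zero] at this
  by_cases ha : t < v (γ.toFun γ.len) <;> by_cases hb : t < v (γ.toFun 0)
  · rw [h1 _ ha, h1 _ hb, one_mul, one_mul]; exact eta_curve hρ P γ m1 m0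
  · rw [h1 _ ha, h2 _ hb, one_mul, zero_mul, sub_zero]
    exact hx _ 0 (by unfold CrossC; intro hc; exact not_le.2 ha (hc.1 (not_lt.1 hb))) m1
  · rw [h2 _ ha, h1 _ hb, one_mul, zero_mul, zero_sub, abs_neg]
    exact hx _ 0 (by unfold CrossC; intro hc; exact not_le.2 hb (hc.2 (not_lt.1 ha))) m0
  · rw [h2 _ ha, h2 _ hb]; simp

lemma exists_q {t : ℤ → ℝ} {h : ℝ} (hh : 0 < h)
    (ht : ∀ i : ℤ, t i ∈ Ioc ((i:ℝ) * h) (((i:ℝ) + 1) * h)) (y : ℝ) :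
    ∃ q : ℤ, (∀ i, i ≤ q ↔ t i < y) ∧ |h * q - y| ≤ 2 * h := by
  have hbd : ∃ b : ℤ, ∀ z : ℤ, t z < y → z ≤ b := by
    refine ⟨⌈y / h⌉, fun z hz => ?_⟩
    have h1 : (z:ℝ) * h < y := (ht z).1.trans hz
    have h2 : (z:ℝ) < y / h := (lt_div_iff₀ hh).2 h1
    exact_mod_cast h2.le.trans (Int.le_ceil _)
  have hinh : ∃ z : ℤ, t z < y := by
    refine ⟨⌊y / h⌋ - 2, ?_⟩
    have h1 := (ht (⌊y / h⌋ - 2)).2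
    have h2 : (⌊y / h⌋ : ℝ) * h ≤ y := (le_div_iff₀ hh).1 (Int.floor_le _)
    push_cast at h1
    nlinarith
  obtain ⟨q, hq, hmax⟩ := Int.exists_greatest_of_bdd hbd hinh
  refine ⟨q, fun i => ⟨fun hi => ?_, hmax i⟩, ?_⟩
  · rcases hi.eq_or_lt with rfl | hi
    · exact hq
    · have h1 : (i:ℝ) + 1 ≤ q := by exact_mod_cast hi
      have := mul_le_mul_of_nonneg_right h1 hh.le
      linarith [(ht i).2, (ht q).1]
  · have h1 : y ≤ t (q + 1) := by
      by_contra hc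
      have := hmax _ (not_le.1 hc)
      omega
    have h2 := (ht (q + 1)).2
    have h3 := (ht q).1
    push_cast at h2
    rw [abs_le]; constructor <;> nlinarith

lemma q_sum {I : Finset ℤ} {a b : ℤ} (hI : ∀ i, ¬ (i ≤ a ↔ i ≤ b) → i ∈ I) :
    (a:ℝ) - b = ∑ i ∈ I, ((if i ≤ a then (1:ℝ) else 0) - (if i ≤ b then 1 else 0)) := by
  wlog hab : b ≤ a generalizing a b
  · have := this (a := b) (b := a) (fun i hi => hI i (fun h => hi h.symm)) (by omega)
    rw [← neg_sub, this, ← Finset.sum_neg_distrib]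
    exact Finset.sum_congr rfl fun i _ => by ring
  have hsub : Finset.Ioc b a ⊆ I := by
    intro i hi
    rw [Finset.mem_Ioc] at hi
    exact hI i (by omega)
  rw [← Finset.sum_subset hsub]
  · rw [Finset.sum_congr rfl (g := fun _ => (1:ℝ))]
    · simp only [Finset.sum_const, Int.card_Ioc, nsmul_eq_mul, mul_one]
      have : ((a - b).toNat : ℤ) = a - b := Int.toNat_of_nonneg (by omega)
      have h2 : (((a - b).toNat : ℤ) : ℝ) = ((a - b : ℤ) : ℝ) := by rw [this]
      push_cast at h2
      exact h2.symm
    · intro i hi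
      rw [Finset.mem_Ioc] at hi
      rw [if_pos hi.2, if_neg (by omega)]; simp
  · intro i _ hi
    rw [Finset.mem_Ioc] at hi
    by_cases h1 : i ≤ b
    · rw [if_pos (by omega), if_pos h1]; simp
    · rw [if_neg (by omega), if_neg h1]; simp


lemma approx {X : Type*} [MetricSpace X] [Nonempty X] [MeasurableSpace X] [BorelSpace X]
    (h1 : μH[1] (Set.univ : Set X) < ⊤) (C₀ : ℝ)
    (hdens : ∀ x : X, Filter.liminf
      (fun r : ℝ => μH[1] (Metric.ball x r) / ENNReal.ofReal r) (𝓝[>] 0)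
      < ENNReal.ofReal C₀) {v : X → ℝ} {τ : ℝ}
    (hv : pVar v < ⊤) (hτ : 1 < τ) {h : ℝ} (hh : 0 < h) :
    ∃ (U : X → ℝ) (G : X → ℝ≥0∞), IsUpperGradient U G ∧
      ∫⁻ x, G x ∂μH[1] ≤ ENNReal.ofReal C₀ * (ENNReal.ofReal ((1 + 2 * τ) * τ) * pVar v) ∧
      ∫⁻ x, ENNReal.ofReal |U x - v x| ∂μH[1] ≤ ENNReal.ofReal h * (2 * μH[1] (univ : Set X) +
        ENNReal.ofReal C₀ * (ENNReal.ofReal ((1 + 2 * τ) * τ) * pVar v)) := by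
  obtain ⟨t, P, I, ht, hP, hPI, hsum⟩ := levels h1 hv hτ hh
  have hrad : ∀ p : X, ∃ ρ : ℝ, 0 < ρ ∧ ρ < h ∧
      μH[1] (Metric.ball p ρ) ≤ ENNReal.ofReal C₀ * ENNReal.ofReal ρ := by
    intro p
    have f1 := Filter.frequently_lt_of_liminf_lt (by isBoundedDefault) (hdens p)
    have f2 : ∀ᶠ r in 𝓝[>] (0:ℝ), r ∈ Ioo 0 h := Ioo_mem_nhdsGT hh
    obtain ⟨r, hr, hr2⟩ := (f1.and_eventually f2).exists
    refine ⟨r, hr2.1, hr2.2, ?_⟩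
    exact (ENNReal.div_le_iff_le_mul (Or.inl (by simpa using hr2.1)) (Or.inl ENNReal.ofReal_ne_top)).1 hr.le
  choose ρ hρ hρh hρμ using hrad
  choose q hq hqb using fun x => exists_q hh ht (v x)
  let χ : ℤ → X → ℝ := fun i x => if i ≤ q x then 1 else 0
  have hχ1 : ∀ i x, t i < v x → χ i x = 1 := fun i x hx => if_pos ((hq x i).2 hx)
  have hχ2 : ∀ i x, ¬ t i < v x → χ i x = 0 := fun i x hx => if_neg (fun hc => hx ((hq x i).1 hc))
  have hχ01 : ∀ i x, 0 ≤ χ i x ∧ χ i x ≤ 1 := fun i x => by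
    simp only [χ]; split_ifs <;> simp
  let U : X → ℝ := fun x => h * q x - h * ∑ i ∈ I, χ i x * (1 - eta ρ (P i) x)
  let G : X → ℝ≥0∞ := fun x => ∑ i ∈ I, ENNReal.ofReal h * ∑ p ∈ P i, gP ρ p x
  have hgm : ∀ p, Measurable (gP ρ p) := fun p =>
    measurable_const.indicator Metric.isOpen_ball.measurableSet
  refine ⟨U, G, ⟨?_, ?_⟩, ?_, ?_⟩
  · exact Finset.measurable_sum _ fun i _ => (Finset.measurable_sum _ fun p _ => hgm p).const_mul _
  · intro γ
    set x := γ.toFun γ.len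
    set y := γ.toFun 0
    have hqs : (q x : ℝ) - q y = ∑ i ∈ I, (χ i x - χ i y) := by
      refine q_sum fun i hi => ?_
      by_contra hiI
      have hc : CrossC v (t i) γ := by
        unfold CrossC
        intro hc
        apply hi
        rw [hq, hq, ← not_le, ← not_le]
        exact not_congr hc.symm
      obtain ⟨s, hs, hsS⟩ := cross_hit hc
      rw [hP, hPI i hiI] at hsS
      simp at hsS
    have hU : U x - U y = ∑ i ∈ I, h * (χ i x * eta ρ (P i) x - χ i y * eta ρ (P i) y) := by
      have : U x - U y = h * ((q x : ℝ) - q y) - h * ∑ i ∈ I, χ i x * (1 - eta ρ (P i) x)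
        + h * ∑ i ∈ I, χ i y * (1 - eta ρ (P i) y) := by simp only [U]; ring
      rw [this, hqs, Finset.mul_sum, Finset.mul_sum, Finset.mul_sum, ← Finset.sum_sub_distrib,
        ← Finset.sum_add_distrib]
      exact Finset.sum_congr rfl fun i _ => by ring
    rw [hU]
    refine (ENNReal.ofReal_le_ofReal (Finset.abs_sum_le_sum_abs _ _)).trans ?_
    rw [ENNReal.ofReal_sum_of_nonneg (fun _ _ => abs_nonneg _)]
    refine le_trans (Finset.sum_le_sum fun i _ => ?_)
      (sum_lint_le _ I (fun i s => ENNReal.ofReal h * ∑ p ∈ P i, gP ρ p (γ.toFun s)))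
    rw [abs_mul, abs_of_pos hh, ENNReal.ofReal_mul hh.le]
    refine le_trans ?_ (lintegral_const_mul_le _ _)
    gcongr
    exact level_curve hρ (hP i) (χ i) (hχ1 i) (hχ2 i) γ
  · simp only [G]
    rw [lintegral_finsetSum _ (fun i _ => (Finset.measurable_sum _ fun p _ => hgm p).const_mul _)]
    calc _ ≤ ∑ i ∈ I, ENNReal.ofReal C₀ * (ENNReal.ofReal h * (P i).card) := by
          refine Finset.sum_le_sum fun i _ => ?_
          rw [lintegral_const_mul _ (Finset.measurable_sum _ fun p _ => hgm p),
            lintegral_finsetSum _ (fun p _ => hgm p), mul_left_comm]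
          gcongr
          calc _ ≤ ∑ p ∈ P i, ENNReal.ofReal C₀ := by
                refine Finset.sum_le_sum fun p _ => ?_
                simp only [gP]
                rw [lintegral_indicator_const Metric.isOpen_ball.measurableSet, mul_comm]
                exact ENNReal.div_le_of_le_mul (hρμ p)
            _ = _ := by rw [Finset.sum_const, nsmul_eq_mul, mul_comm]
      _ = ENNReal.ofReal C₀ * ∑ i ∈ I, ENNReal.ofReal h * (P i).card := by rw [Finset.mul_sum]
      _ ≤ _ := by gcongr
  · have hbm : ∀ p, Measurable ((Metric.ball p (ρ p)).indicator (1 : X → ℝ≥0∞)) := fun p =>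
      measurable_one.indicator Metric.isOpen_ball.measurableSet
    have hpt : ∀ x, ENNReal.ofReal |U x - v x| ≤ ENNReal.ofReal (2 * h) +
        ∑ i ∈ I, ENNReal.ofReal h * ∑ p ∈ P i, (Metric.ball p (ρ p)).indicator 1 x := by
      intro x
      have e1 : |U x - v x| ≤ 2 * h + ∑ i ∈ I, h * (1 - eta ρ (P i) x) := by
        have e2 : U x - v x = (h * q x - v x) - ∑ i ∈ I, h * (χ i x * (1 - eta ρ (P i) x)) := by
          simp only [U]; rw [Finset.mul_sum]; ring
        rw [e2]
        refine (abs_sub _ _).trans (add_le_add (hqb x) ?_)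
        refine (Finset.abs_sum_le_sum_abs _ _).trans (Finset.sum_le_sum fun i _ => ?_)
        have e3 : 0 ≤ 1 - eta ρ (P i) x := sub_nonneg.2 (eta_le hρ _ _)
        rw [abs_of_nonneg (mul_nonneg hh.le (mul_nonneg (hχ01 i x).1 e3))]
        exact mul_le_mul_of_nonneg_left (mul_le_of_le_one_left e3 (hχ01 i x).2) hh.le
      refine (ENNReal.ofReal_le_ofReal e1).trans ?_
      have e3 : ∀ i ∈ I, 0 ≤ h * (1 - eta ρ (P i) x) :=
        fun i _ => mul_nonneg hh.le (sub_nonneg.2 (eta_le hρ _ _))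
      rw [ENNReal.ofReal_add (by positivity) (Finset.sum_nonneg e3),
        ENNReal.ofReal_sum_of_nonneg e3]
      gcongr with i _
      rw [ENNReal.ofReal_mul hh.le]
      gcongr
      exact one_sub_eta_le hρ _ _
    refine (lintegral_mono hpt).trans ?_
    rw [lintegral_add_left measurable_const, lintegral_const,
      lintegral_finsetSum _ (fun i _ => (Finset.measurable_sum _ fun p _ => hbm p).const_mul _), mul_add]
    refine add_le_add ?_ ?_
    · rw [mul_comm 2 h, ENNReal.ofReal_mul hh.le, mul_assoc]; simp
    calc _ ≤ ∑ i ∈ I, ENNReal.ofReal h * (ENNReal.ofReal C₀ * (ENNReal.ofReal h * (P i).card)) := by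
          refine Finset.sum_le_sum fun i _ => ?_
          rw [lintegral_const_mul _ (Finset.measurable_sum _ fun p _ => hbm p),
            lintegral_finsetSum _ (fun p _ => hbm p)]
          gcongr
          calc _ ≤ ∑ p ∈ P i, ENNReal.ofReal C₀ * ENNReal.ofReal h := by
                refine Finset.sum_le_sum fun p _ => ?_
                rw [lintegral_indicator_one Metric.isOpen_ball.measurableSet]
                exact (hρμ p).trans (by gcongr; exact (hρh p).le)
            _ = _ := by rw [Finset.sum_const, nsmul_eq_mul]; ring
      _ = ENNReal.ofReal h * (ENNReal.ofReal C₀ * ∑ i ∈ I, ENNReal.ofReal h * (P i).card) := by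
          simp only [Finset.mul_sum]
      _ ≤ _ := by gcongr

lemma tv_le {X : Type*} [MetricSpace X] [Nonempty X] [MeasurableSpace X] [BorelSpace X]
    (h1 : μH[1] (Set.univ : Set X) < ⊤) (C₀ : ℝ) (hC₀ : 0 < C₀)
    (hdens : ∀ x : X, Filter.liminf
      (fun r : ℝ => μH[1] (Metric.ball x r) / ENNReal.ofReal r) (𝓝[>] 0)
      < ENNReal.ofReal C₀) {u v : X → ℝ} (huv : v =ᵐ[μH[1]] u) :
    totalVarH (μH[1]) u ≤ ENNReal.ofReal (C₀ * (3 + 4 * C₀)) * pVar v := by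
  by_cases hv : pVar v = ⊤
  · rw [hv, ENNReal.mul_top]
    · exact le_top
    · simpa using (by positivity : 0 < C₀ * (3 + 4 * C₀))
  have hv' : pVar v < ⊤ := lt_top_iff_ne_top.2 hv
  obtain ⟨τ, hτ, hτC⟩ : ∃ τ : ℝ, 1 < τ ∧ (1 + 2 * τ) * τ ≤ 3 + 4 * C₀ := by
    refine ⟨1 + min (C₀ / 2) (1 / 2), by linarith [show 0 < min (C₀ / 2) (1 / 2) by positivity], ?_⟩
    have a0 : 0 < min (C₀ / 2) (1 / 2) := by positivity
    have a1 := min_le_left (C₀ / 2) (1 / 2)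
    have a2 := min_le_right (C₀ / 2) (1 / 2)
    nlinarith
  choose U G hUG hG hU using fun n : ℕ => approx h1 C₀ hdens hv' hτ
    (h := 1 / ((n:ℝ) + 1)) (by positivity)
  set K := ENNReal.ofReal C₀ * (ENNReal.ofReal ((1 + 2 * τ) * τ) * pVar v) with hK
  have hKtop : K ≠ ⊤ := ENNReal.mul_ne_top ENNReal.ofReal_ne_top
    (ENNReal.mul_ne_top ENNReal.ofReal_ne_top hv)
  have hKle : K ≤ ENNReal.ofReal (C₀ * (3 + 4 * C₀)) * pVar v := by
    rw [hK, ← mul_assoc, ← ENNReal.ofReal_mul hC₀.le]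
    gcongr
  have hlim : Tendsto (fun i => ∫⁻ x, ENNReal.ofReal |U i x - u x| ∂μH[1]) atTop (𝓝 0) := by
    have e : ∀ i, ∫⁻ x, ENNReal.ofReal |U i x - u x| ∂μH[1]
        = ∫⁻ x, ENNReal.ofReal |U i x - v x| ∂μH[1] := fun i =>
      lintegral_congr_ae (huv.mono fun x hx => by simp only [hx])
    simp only [e]
    refine tendsto_of_tendsto_of_tendsto_of_le_of_le tendsto_const_nhds ?_ (fun _ => zero_le) hU
    have l1 : Tendsto (fun n : ℕ => ENNReal.ofReal (1 / ((n:ℝ) + 1))) atTop (𝓝 0) := by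
      simpa using ENNReal.tendsto_ofReal (tendsto_one_div_add_atTop_nhds_zero_nat (𝕜 := ℝ))
    have l2 := ENNReal.Tendsto.mul_const (b := 2 * μH[1] (univ : Set X) + K) l1
      (Or.inr (ENNReal.add_ne_top.2 ⟨ENNReal.mul_ne_top (by simp) h1.ne, hKtop⟩))
    simpa using l2
  calc totalVarH (μH[1]) u ≤ atTop.liminf (fun i => ∫⁻ x, G i x ∂μH[1]) := by
        unfold totalVarH
        exact iInf_le_of_le U (iInf_le_of_le G (iInf_le_of_le hUG (iInf_le_of_le hlim le_rfl)))
    _ ≤ K := (liminf_le_liminf (Eventually.of_forall hG)).trans (by simp)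
    _ ≤ _ := hKle

theorem stmt1 {X : Type*} [MetricSpace X] [CompleteSpace X] [ConnectedSpace X]
    [MeasurableSpace X] [BorelSpace X]
    (h0 : 0 < μH[1] (Set.univ : Set X)) (h1 : μH[1] (Set.univ : Set X) < ⊤)
    (C₀ : ℝ) (hC₀ : 0 < C₀)
    (hdens : ∀ x : X, Filter.liminf
      (fun r : ℝ => μH[1] (Metric.ball x r) / ENNReal.ofReal r) (𝓝[>] 0)
      < ENNReal.ofReal C₀)
    (u : X → ℝ) (hu : VarH (μH[1]) u < ⊤) :
    totalVarH (μH[1]) u ≤ ENNReal.ofReal (C₀ * (3 + 4 * C₀)) * VarH (μH[1]) u := by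
  have hc0 : ENNReal.ofReal (C₀ * (3 + 4 * C₀)) ≠ 0 := by
    simpa using (by positivity : 0 < C₀ * (3 + 4 * C₀))
  have key : totalVarH (μH[1]) u / ENNReal.ofReal (C₀ * (3 + 4 * C₀)) ≤ VarH (μH[1]) u := by
    unfold VarH
    refine le_iInf₂ fun v hv => ?_
    exact ENNReal.div_le_of_le_mul' (tv_le h1 C₀ hC₀ hdens hv)
  rw [mul_comm]
  exact (ENNReal.div_le_iff_le_mul (Or.inl hc0) (Or.inl ENNReal.ofReal_ne_top)).1 key
end

section
/- Let X = [a,b] ⊂ ℝ with the Euclidean metric and Lebesgue (= ℋ¹) measure. For every function u : [a,b] → ℝ, Var(u,[a,b]) = eV(u,[a,b]), i.e. the infimum over representatives of the curve-based pointwise variation pV coincides with the classical essential variation. -/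
open MeasureTheory Set Filter Topology ENNReal

lemma aux_image_sup {a b : ℝ} (γ : MCurve (Set.Icc a b)) :
    Set.uIcc (γ.toFun 0) (γ.toFun γ.len) ⊆ γ.image := by
  have hc : ContinuousOn γ.toFun (Set.Icc 0 γ.len) := by
    have hl : LipschitzOnWith 1 γ.toFun (Set.Icc 0 γ.len) := by
      intro x hx y hy
      wlog hxy : x ≤ y generalizing x y
      · rw [edist_comm, edist_comm x y]
        exact this hy hx (le_of_not_ge hxy)
      have h1 := eVariationOn.edist_le γ.toFun (s := Set.Icc x y) (x := x) (y := y)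
        ⟨le_rfl, hxy⟩ ⟨hxy, le_rfl⟩
      rw [γ.arclength x y hx hy hxy] at h1
      rw [edist_comm x y, edist_dist y x, Real.dist_eq, abs_of_nonneg (sub_nonneg.2 hxy)]
      simpa using h1
    exact hl.continuousOn
  have hp : IsPreconnected γ.image := isPreconnected_Icc.image _ hc
  exact hp.ordConnected.uIcc_subset ⟨0, ⟨le_rfl, γ.len_nonneg⟩, rfl⟩
    ⟨γ.len, ⟨γ.len_nonneg, le_rfl⟩, rfl⟩

lemma aux_sum_disjoint {X ι : Type*} [LinearOrder X] [DecidableEq ι] (v : X → ℝ) (p q : ι → X)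
    (hpq : ∀ i, p i ≤ q i)
    (hd : ∀ i j, i ≠ j → Disjoint (Set.Icc (p i) (q i)) (Set.Icc (p j) (q j))) (S : Finset ι) :
    ∑ i ∈ S, eVariationOn v (Set.Icc (p i) (q i)) ≤
      eVariationOn v (⋃ i ∈ S, Set.Icc (p i) (q i)) := by
  induction S using Finset.induction_on_max_value p with
  | empty => simp
  | insert i s his hmax ih =>
    rw [Finset.sum_insert his, add_comm, Finset.set_biUnion_insert, Set.union_comm]
    refine (add_le_add_left ih _).trans (eVariationOn.add_le_union v ?_)
    intro x hx y hy
    simp only [Set.mem_iUnion] at hx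
    obtain ⟨j, hj, hx⟩ := hx
    refine le_trans ?_ hy.1
    by_contra! hlt
    have hne : i ≠ j := fun h => his (h ▸ hj)
    exact Set.disjoint_left.1 (hd i j hne) ⟨le_rfl, hpq i⟩ ⟨hmax j hj, hlt.le.trans hx.2⟩

lemma aux_pVar_le {a b : ℝ} (v : Set.Icc a b → ℝ) : pVar v ≤ eVariationOn v Set.univ := by
  unfold pVar
  refine iSup_le fun n => iSup_le fun γ => iSup_le fun _ => iSup_le fun hd => ?_
  have h := aux_sum_disjoint v (fun i => (γ i).toFun 0 ⊓ (γ i).toFun (γ i).len)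
    (fun i => (γ i).toFun 0 ⊔ (γ i).toFun (γ i).len) (fun i => inf_le_sup)
    (fun i j hij => (hd i j hij).mono (aux_image_sup _) (aux_image_sup _)) Finset.univ
  refine le_trans (Finset.sum_le_sum fun i _ => ?_) (h.trans (eVariationOn.mono v (subset_univ _)))
  rw [← Real.dist_eq, ← edist_dist]
  exact eVariationOn.edist_le v (s := Set.uIcc _ _) Set.right_mem_uIcc Set.left_mem_uIcc

/-- the segment from `p` to `q` -/
noncomputable def segCurve {a b : ℝ} (hab : a ≤ b) (p q : Set.Icc a b) (h : p ≤ q) :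
    MCurve (Set.Icc a b) where
  len := q - p
  len_nonneg := sub_nonneg.2 h
  toFun t := Set.projIcc a b hab (p + t)
  arclength := by
    intro s t hs ht hst
    have hv : ∀ x ∈ Set.Icc s t, (Set.projIcc a b hab (p + x) : ℝ) = p + x := by
      intro x hx
      have h1 := p.2.1
      have h2 := q.2.2
      have h3 := hs.1
      have h4 := ht.2
      have h5 := hx.1
      have h6 := hx.2
      rw [Set.projIcc_of_mem hab ⟨by linarith, by linarith⟩]
    have e : eVariationOn (fun t => Set.projIcc a b hab (p + t)) (Set.Icc s t)
        = eVariationOn (fun t => (Set.projIcc a b hab (p + t) : ℝ)) (Set.Icc s t) := rfl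
    rw [e, eVariationOn.eq_of_eqOn (f' := fun x => (p : ℝ) + x) hv]
    have hm : MonotoneOn (fun x => (p : ℝ) + x) (Set.Icc s t) := fun x _ y _ hxy => by
      simpa using hxy
    apply le_antisymm
    · have := hm.eVariationOn_le (a := s) (b := t) ⟨le_rfl, hst⟩ ⟨hst, le_rfl⟩
      simpa using this
    · have := eVariationOn.edist_le (fun x => (p : ℝ) + x) (s := Set.Icc s t) (x := t) (y := s)
        ⟨hst, le_rfl⟩ ⟨le_rfl, hst⟩
      rw [edist_dist, Real.dist_eq] at this
      simpa [abs_of_nonneg (sub_nonneg.2 hst)] using this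

lemma segCurve_coe {a b : ℝ} (hab : a ≤ b) (p q : Set.Icc a b) (h : p ≤ q) (x : ℝ)
    (hx : x ∈ Set.Icc 0 (segCurve hab p q h).len) :
    ((segCurve hab p q h).toFun x : ℝ) = p + x := by
  have h1 := p.2.1
  have h2 := q.2.2
  have h3 := hx.1
  have h4 : x ≤ (q : ℝ) - p := hx.2
  show (Set.projIcc a b hab (p + x) : ℝ) = p + x
  rw [Set.projIcc_of_mem hab ⟨by linarith, by linarith⟩]

lemma segCurve_zero {a b : ℝ} (hab : a ≤ b) (p q : Set.Icc a b) (h : p ≤ q) :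
    (segCurve hab p q h).toFun 0 = p := by
  apply Subtype.ext
  rw [segCurve_coe hab p q h 0 ⟨le_rfl, (segCurve hab p q h).len_nonneg⟩, add_zero]

lemma segCurve_len {a b : ℝ} (hab : a ≤ b) (p q : Set.Icc a b) (h : p ≤ q) :
    (segCurve hab p q h).toFun (segCurve hab p q h).len = q := by
  apply Subtype.ext
  rw [segCurve_coe hab p q h _ ⟨(segCurve hab p q h).len_nonneg, le_rfl⟩]
  show (p : ℝ) + (q - p) = q
  ring

lemma segCurve_simple {a b : ℝ} (hab : a ≤ b) (p q : Set.Icc a b) (h : p ≤ q) :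
    (segCurve hab p q h).IsSimple := by
  intro x hx y hy hxy
  have := congrArg Subtype.val hxy
  rw [segCurve_coe hab p q h x hx, segCurve_coe hab p q h y hy] at this
  linarith

lemma segCurve_image {a b : ℝ} (hab : a ≤ b) (p q : Set.Icc a b) (h : p ≤ q) :
    (segCurve hab p q h).image ⊆ Set.Icc p q := by
  rintro _ ⟨x, hx, rfl⟩
  have h3 := hx.1
  have h4 : x ≤ (q : ℝ) - p := hx.2
  constructor
  · rw [← Subtype.coe_le_coe, segCurve_coe hab p q h x hx]; linarith
  · rw [← Subtype.coe_le_coe, segCurve_coe hab p q h x hx]; linarith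

lemma aux_le_pVar {a b : ℝ} (hab : a ≤ b) (v : Set.Icc a b → ℝ) (S : Finset ℕ)
    (p q : ℕ → Set.Icc a b) (h1 : ∀ i ∈ S, p i ≤ q i)
    (h2 : ∀ i ∈ S, ∀ j ∈ S, i < j → q i < p j) :
    ∑ i ∈ S, edist (v (q i)) (v (p i)) ≤ pVar v := by
  let e := S.equivFin.symm
  let γ : Fin S.card → MCurve (Set.Icc a b) := fun i =>
    segCurve hab (p (e i)) (q (e i)) (h1 _ (e i).2)
  have key : ∑ i, ENNReal.ofReal |v ((γ i).toFun (γ i).len) - v ((γ i).toFun 0)| ≤ pVar v := by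
    unfold pVar
    refine le_iSup_of_le S.card (le_iSup_of_le γ (le_iSup_of_le
      (fun i => segCurve_simple _ _ _ _) (le_iSup_of_le ?_ le_rfl)))
    intro i j hij
    refine Disjoint.mono (segCurve_image _ _ _ _) (segCurve_image _ _ _ _) ?_
    have hne : (e i : ℕ) ≠ e j := fun h => hij (e.injective (Subtype.ext h))
    rw [Set.disjoint_left]
    intro x hx hx'
    rcases lt_or_gt_of_ne hne with h | h
    · exact absurd (hx'.1.trans hx.2) (not_le.2 (h2 _ (e i).2 _ (e j).2 h))
    · exact absurd (hx.1.trans hx'.2) (not_le.2 (h2 _ (e j).2 _ (e i).2 h))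
  refine le_trans (le_of_eq ?_) key
  rw [← Finset.sum_coe_sort S, ← e.sum_comp]
  refine Finset.sum_congr rfl fun i _ => ?_
  simp only [γ, segCurve_zero, segCurve_len]
  rw [edist_dist, Real.dist_eq]

lemma aux_le_two {a b : ℝ} (hab : a ≤ b) (v : Set.Icc a b → ℝ) :
    eVariationOn v Set.univ ≤ pVar v + pVar v := by
  rw [eVariationOn.eVariationOn_eq_strictMonoOn]
  refine iSup_le ?_
  rintro ⟨n, t, ht, -⟩
  dsimp only
  rw [← Finset.sum_filter_add_sum_filter_not (Finset.range n) (fun i => Even i)]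
  gcongr
  · refine aux_le_pVar hab v _ t (fun i => t (i + 1)) ?_ ?_
    · intro i hi
      simp only [Finset.mem_filter, Finset.mem_range] at hi
      exact (ht (by simp; omega) (by simp; omega) (Nat.lt_succ_self i)).le
    · intro i hi j hj hij
      simp only [Finset.mem_filter, Finset.mem_range] at hi hj
      refine ht (by simp; omega) (by simp; omega) ?_
      grind
  · refine aux_le_pVar hab v _ t (fun i => t (i + 1)) ?_ ?_
    · intro i hi
      simp only [Finset.mem_filter, Finset.mem_range] at hi
      exact (ht (by simp; omega) (by simp; omega) (Nat.lt_succ_self i)).le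
    · intro i hi j hj hij
      simp only [Finset.mem_filter, Finset.mem_range] at hi hj
      refine ht (by simp; omega) (by simp; omega) ?_
      grind

lemma aux_exists {a b : ℝ} {v : Set.Icc a b → ℝ} (hv : BoundedVariationOn v Set.univ)
    (x c : Set.Icc a b) (hxc : x < c) {ε : ℝ≥0∞} (hε : 0 < ε) :
    ∃ y, x < y ∧ y < c ∧ edist (v.rightLim x) (v y) < ε := by
  have hab : a < b := x.2.1.trans_lt (lt_of_lt_of_le (show (x : ℝ) < c from hxc) c.2.2)
  have h1 := hv.tendsto_rightLim x
  have h2 : ∀ᶠ y in 𝓝[>] x, edist (v y) (v.rightLim x) < ε := h1 (Metric.eball_mem_nhds _ hε)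
  have h3 : ∀ᶠ y in 𝓝[>] x, y ∈ Set.Ioo x c := Ioo_mem_nhdsGT hxc
  have : (𝓝[>] x).NeBot := nhdsGT_neBot_of_exists_gt ⟨c, hxc⟩
  obtain ⟨y, hy, hy'⟩ := (h2.and h3).exists
  exact ⟨y, hy'.1, hy'.2, by rwa [edist_comm]⟩

lemma aux_rightLim_le {a b : ℝ} (hab : a ≤ b) {v : Set.Icc a b → ℝ}
    (hv : BoundedVariationOn v Set.univ) :
    eVariationOn v.rightLim Set.univ ≤ pVar v := by
  rw [eVariationOn.eVariationOn_eq_strictMonoOn]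
  refine iSup_le ?_
  rintro ⟨n, t, ht, -⟩
  dsimp only
  refine ENNReal.le_of_forall_pos_le_add fun δ hδ _ => ?_
  let ε : ℝ≥0∞ := δ / (2 * (n + 1))
  have hε : 0 < ε := ENNReal.div_pos (by simpa using hδ.ne') (by finiteness)
  have hp : ∀ k, ∃ y, k < n → t k < y ∧ y < t (k + 1) ∧ edist (v.rightLim (t k)) (v y) < ε := by
    intro k
    by_cases hk : k < n
    · obtain ⟨y, hy⟩ := aux_exists hv (t k) (t (k + 1))
        (ht (by simp; omega) (by simp; omega) (Nat.lt_succ_self k)) hε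
      exact ⟨y, fun _ => hy⟩
    · exact ⟨t k, fun h => absurd h hk⟩
  choose p hp using hp
  have hq : ∀ k, ∃ y, k ≤ n → t k ≤ y ∧ (k < n → y < p k) ∧ edist (v.rightLim (t k)) (v y) < ε := by
    intro k
    by_cases hk : k < n
    · obtain ⟨y, hy⟩ := aux_exists hv (t k) (p k) (hp k hk).1 hε
      exact ⟨y, fun _ => ⟨hy.1.le, fun _ => hy.2.1, hy.2.2⟩⟩
    · by_cases htop : ∃ c, t k < c
      · obtain ⟨c, hc⟩ := htop
        obtain ⟨y, hy⟩ := aux_exists hv (t k) c hc hε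
        exact ⟨y, fun _ => ⟨hy.1.le, fun h => absurd h hk, hy.2.2⟩⟩
      · push Not at htop
        refine ⟨t k, fun _ => ⟨le_rfl, fun h => absurd h hk, ?_⟩⟩
        rw [rightLim_eq_of_isTop htop, edist_self]
        exact hε
  choose q hq using hq
  have key := aux_le_pVar hab v (Finset.range n) p (fun i => q (i + 1))
    (fun i hi => by
      have hi := Finset.mem_range.1 hi
      exact (hp i hi).2.1.le.trans (hq (i + 1) hi).1)
    (fun i hi j hj hij => by
      have hi := Finset.mem_range.1 hi
      have hj := Finset.mem_range.1 hj
      have hqp := (hq (i + 1) (by omega)).2.1 (by omega)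
      rcases Nat.lt_or_ge (i + 1) j with h | h
      · refine hqp.trans ((hp (i + 1) (by omega)).2.1.trans_le ?_)
        refine le_trans ?_ (hp j hj).1.le
        exact ht.monotoneOn (by simp; omega) (by simp; omega) (by omega)
      · have : j = i + 1 := by omega
        rw [this]; exact hqp)
  calc ∑ i ∈ Finset.range n, edist (v.rightLim (t (i + 1))) (v.rightLim (t i))
      ≤ ∑ i ∈ Finset.range n, (edist (v (q (i + 1))) (v (p i)) + 2 * ε) := by
        refine Finset.sum_le_sum fun i hi => ?_
        have hi := Finset.mem_range.1 hi
        have e1 := (hq (i + 1) hi).2.2.le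
        have e2 := (hp i hi).2.2.le
        rw [edist_comm] at e2
        calc _ ≤ _ := edist_triangle4 _ (v (q (i + 1))) (v (p i)) _
          _ ≤ ε + edist (v (q (i + 1))) (v (p i)) + ε := by gcongr
          _ = _ := by ring
    _ = ∑ i ∈ Finset.range n, edist (v (q (i + 1))) (v (p i)) + n * (2 * ε) := by
        rw [Finset.sum_add_distrib]; simp
    _ ≤ pVar v + δ := by
        gcongr
        calc (n : ℝ≥0∞) * (2 * ε) ≤ (n + 1) * (2 * ε) := by gcongr; exact le_self_add
          _ = (2 * (n + 1)) * ε := by ring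
          _ ≤ δ := ENNReal.mul_div_le

lemma aux_ae {a b : ℝ} {v : Set.Icc a b → ℝ} (hv : BoundedVariationOn v Set.univ) :
    v.rightLim =ᵐ[(μH[1] : Measure (Set.Icc a b))] v := by
  obtain ⟨f, g, hf, hg, hfg⟩ := hv.locallyBoundedVariationOn.exists_monotoneOn_sub_monotoneOn
  rw [monotoneOn_univ] at hf hg
  have hc := hf.countable_not_continuousAt.union hg.countable_not_continuousAt
  have : NullSingletonClass (μH[1] : Measure (Set.Icc a b)) := Measure.nullSingletonClass_hausdorff _ one_pos
  have h0 := hc.measure_zero (μH[1] : Measure (Set.Icc a b))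
  filter_upwards [compl_mem_ae_iff.2 h0] with x hx
  simp only [Set.mem_compl_iff, Set.mem_union, Set.mem_ofPred_eq, not_or, not_not] at hx
  have hcv : ContinuousAt v x := by rw [hfg]; exact hx.1.sub hx.2
  exact hcv.continuousWithinAt.rightLim_eq

/-- On `X = [a,b] ⊂ ℝ`, the curve-based `Var` coincides with the classical essential
variation `eV`, defined as the infimum over representatives of the classical pointwise
variation (formalized via `eVariationOn`). -/
theorem stmt3 (a b : ℝ) (hab : a ≤ b) (u : (Set.Icc a b) → ℝ) :
    VarH (μH[1]) u
      = ⨅ (v : (Set.Icc a b) → ℝ) (_ : v =ᵐ[(μH[1] : Measure (Set.Icc a b))] u),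
          eVariationOn v Set.univ := by
  apply le_antisymm
  · exact le_iInf fun v => le_iInf fun hv => iInf_le_of_le v (iInf_le_of_le hv (aux_pVar_le v))
  · refine le_iInf fun v => le_iInf fun hv => ?_
    by_cases hfin : pVar v = ⊤
    · rw [hfin]; exact le_top
    · have hbv : BoundedVariationOn v Set.univ :=
        ne_top_of_le_ne_top (ENNReal.add_ne_top.2 ⟨hfin, hfin⟩) (aux_le_two hab v)
      exact iInf_le_of_le v.rightLim (iInf_le_of_le ((aux_ae hbv).trans hv)
        (aux_rightLim_le hab hbv))
end

section
/- Let (X,d) be a complete and connected metric space with 0 < ℋ¹(X) < ∞. For any function v : X → ℝ, one has pV(v,X) ≤ PV(v,X) ≤ 2·pV(v,X). -/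
open MeasureTheory Set Filter Topology ENNReal

/-- `PV(v, X)`: supremum over finite collections of pairwise disjoint injective arc-length
parametrized curves of the sums of the classical pointwise variations `PV(v∘γⱼ, [0,ℓⱼ])`. -/
noncomputable def PVar {X : Type*} [MetricSpace X] (v : X → ℝ) : ℝ≥0∞ :=
  ⨆ (n : ℕ) (γ : Fin n → MCurve X) (_ : ∀ i, (γ i).IsSimple)
    (_ : ∀ i j, i ≠ j → Disjoint (γ i).image (γ j).image),
    ∑ i, eVariationOn (v ∘ (γ i).toFun) (Set.Icc 0 (γ i).len)

/-- The restriction of a curve to `[a,b]`. -/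
noncomputable def subMC {X : Type*} [MetricSpace X] (γ : MCurve X) (a b : ℝ)
    (ha : 0 ≤ a) (hab : a ≤ b) (hb : b ≤ γ.len) : MCurve X where
  len := b - a
  len_nonneg := sub_nonneg.2 hab
  toFun := fun t => γ.toFun (a + t)
  arclength := by
    intro s t hs ht hst
    have h := eVariationOn.comp_eq_of_monotoneOn γ.toFun (t := Set.Icc s t) (fun x => a + x)
      (fun x _ y _ hxy => by simpa using hxy)
    have h2 := γ.arclength (a + s) (a + t) ⟨by linarith [hs.1], by linarith [hs.2]⟩
      ⟨by linarith [ht.1], by linarith [ht.2]⟩ (by linarith)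
    rw [Set.image_const_add_Icc, h2] at h
    have e : a + t - (a + s) = t - s := by ring
    rw [e] at h
    exact h

theorem subMC_image {X : Type*} [MetricSpace X] (γ : MCurve X) (a b : ℝ)
    (ha : 0 ≤ a) (hab : a ≤ b) (hb : b ≤ γ.len) :
    (subMC γ a b ha hab hb).image = γ.toFun '' Set.Icc a b := by
  have : Set.Icc a b = (fun x => a + x) '' Set.Icc 0 (b - a) := by
    rw [Set.image_const_add_Icc]; simp
  rw [this, Set.image_image]
  rfl

theorem subMC_simple {X : Type*} [MetricSpace X] (γ : MCurve X) (a b : ℝ)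
    (ha : 0 ≤ a) (hab : a ≤ b) (hb : b ≤ γ.len) (hγ : γ.IsSimple) :
    (subMC γ a b ha hab hb).IsSimple := by
  intro x hx y hy hxy
  have hx2 : x ≤ b - a := hx.2
  have hy2 : y ≤ b - a := hy.2
  have := hγ (x₁ := a + x) (x₂ := a + y) ⟨by linarith [hx.1], by linarith⟩
    ⟨by linarith [hy.1], by linarith⟩ hxy
  linarith

theorem le_pVar_fintype {X : Type*} [MetricSpace X] (v : X → ℝ) {ι : Type*} [Fintype ι]
    (γ : ι → MCurve X) (hs : ∀ i, (γ i).IsSimple)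
    (hd : ∀ i j, i ≠ j → Disjoint (γ i).image (γ j).image) :
    ∑ i, ENNReal.ofReal |v ((γ i).toFun (γ i).len) - v ((γ i).toFun 0)| ≤ pVar v := by
  let e := (Fintype.equivFin ι).symm
  rw [← e.sum_comp]
  unfold pVar
  exact le_iSup_of_le (Fintype.card ι) <| le_iSup_of_le (fun i => γ (e i)) <|
    le_iSup_of_le (fun i => hs _) <|
    le_iSup_of_le (fun i j hij => hd _ _ (fun h => hij (e.injective h))) le_rfl

theorem dedupe {f : ℝ → ℝ} {s : Set ℝ} (u : ℕ → ℝ) (hu : Monotone u) (hus : ∀ i, u i ∈ s)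
    (n : ℕ) : ∃ (m : ℕ) (w : ℕ → ℝ), StrictMonoOn w (Set.Iic m) ∧ (∀ i, w i ∈ s) ∧
      w m = u n ∧ ∑ i ∈ Finset.range n, edist (f (u (i + 1))) (f (u i)) =
        ∑ i ∈ Finset.range m, edist (f (w (i + 1))) (f (w i)) := by
  induction n with
  | zero =>
    refine ⟨0, fun _ => u 0, ?_, fun _ => hus 0, rfl, by simp⟩
    intro x hx y hy hxy
    simp only [Set.mem_Iic] at hx hy
    omega
  | succ n ih =>
    obtain ⟨m, w, hw, hws, hwm, hsum⟩ := ih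
    rcases (hu (Nat.le_succ n)).eq_or_lt with h | h
    · refine ⟨m, w, hw, hws, by rw [hwm, h], ?_⟩
      rw [Finset.sum_range_succ, hsum, ← Nat.succ_eq_add_one, ← h]
      simp
    · refine ⟨m + 1, fun i => if i ≤ m then w i else u (n + 1), ?_, ?_, by simp, ?_⟩
      · intro x hx y hy hxy
        simp only [Set.mem_Iic] at hx hy
        have hxm : x ≤ m := by omega
        by_cases hym : y ≤ m
        · simpa [hxm, hym] using hw hxm hym hxy
        · simp only [hxm, hym, if_true, if_false]
          calc w x ≤ w m := hw.monotoneOn hxm (Set.mem_Iic.2 le_rfl) hxm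
            _ < u (n + 1) := by rw [hwm]; exact h
      · intro i
        dsimp only
        split_ifs
        · exact hws i
        · exact hus _
      · rw [Finset.sum_range_succ, Finset.sum_range_succ, hsum]
        congr 1
        · refine Finset.sum_congr rfl fun i hi => ?_
          have := Finset.mem_range.1 hi
          have h1 : i + 1 ≤ m := by omega
          have h2 : i ≤ m := by omega
          simp [h1, h2]
        · simp [hwm]

theorem sum_iSup_le' {ι : Type*} {κ : Type*} [Nonempty κ] (f : ι → κ → ℝ≥0∞) (C : ℝ≥0∞)
    (S : Finset ι) : ∀ D : ℝ≥0∞, (∀ c : ι → κ, D + ∑ i ∈ S, f i (c i) ≤ C) →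
      D + ∑ i ∈ S, ⨆ k, f i k ≤ C := by
  classical
  induction S using Finset.induction_on with
  | empty =>
    intro D h
    simpa using h (fun _ => Classical.arbitrary κ)
  | insert a S ha ih =>
    intro D h
    rw [Finset.sum_insert ha, ← add_assoc, ENNReal.add_iSup, ENNReal.iSup_add]
    refine iSup_le fun k => ih _ fun c => ?_
    have := h (Function.update c a k)
    rw [Finset.sum_insert ha, ← add_assoc, Function.update_self] at this
    convert this using 2
    refine Finset.sum_congr rfl fun i hi => ?_
    have hne : i ≠ a := fun h => ha (h ▸ hi)
    rw [Function.update_of_ne hne]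

/-- Pieces of one parity are disjoint, so their sum is bounded by `pVar`. -/
theorem parity_le {X : Type*} [MetricSpace X] (v : X → ℝ) {n : ℕ} (γ : Fin n → MCurve X)
    (hs : ∀ i, (γ i).IsSimple)
    (hd : ∀ i j, i ≠ j → Disjoint (γ i).image (γ j).image)
    (m : Fin n → ℕ) (w : Fin n → ℕ → ℝ) (hw : ∀ i, StrictMonoOn (w i) (Set.Iic (m i)))
    (hws : ∀ i k, w i k ∈ Set.Icc 0 (γ i).len) (r : ℕ) :
    ∑ i, ∑ k ∈ (Finset.range (m i)).filter (fun k => k % 2 = r),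
      edist ((v ∘ (γ i).toFun) (w i (k + 1))) ((v ∘ (γ i).toFun) (w i k)) ≤ pVar v := by
  let P : Fin n → Finset ℕ := fun i => (Finset.range (m i)).filter (fun k => k % 2 = r)
  have hP : ∀ i k, k ∈ P i → k + 1 ≤ m i ∧ k % 2 = r := by
    intro i k hk
    have := Finset.mem_filter.1 hk
    exact ⟨Finset.mem_range.1 this.1, this.2⟩
  have hle : ∀ i k, k ∈ P i → w i k ≤ w i (k + 1) := fun i k hk =>
    (hw i).monotoneOn (Set.mem_Iic.2 (by have := (hP i k hk).1; omega))
      (Set.mem_Iic.2 (hP i k hk).1) (Nat.le_succ k)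
  let Γ : (Σ i : Fin n, P i) → MCurve X := fun p =>
    subMC (γ p.1) (w p.1 p.2) (w p.1 (p.2 + 1)) (hws _ _).1 (hle _ _ p.2.2) (hws _ _).2
  have key := le_pVar_fintype v Γ (fun p => subMC_simple _ _ _ _ _ _ (hs _)) ?_
  · rw [Fintype.sum_sigma] at key
    refine le_trans (le_of_eq ?_) key
    refine Finset.sum_congr rfl fun i _ => ?_
    rw [← Finset.sum_coe_sort]
    refine Finset.sum_congr rfl fun k _ => ?_
    simp only [Γ, subMC, Function.comp, edist_dist, Real.dist_eq]
    simp
  · have lt_case : ∀ (i : Fin n) (k l : ℕ), k ∈ P i → l ∈ P i → k < l →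
        Disjoint ((γ i).toFun '' Set.Icc (w i k) (w i (k + 1)))
          ((γ i).toFun '' Set.Icc (w i l) (w i (l + 1))) := by
      intro i k l hk hl hkl
      rw [Set.disjoint_left]
      rintro x ⟨a, ha, rfl⟩ ⟨b, hb, hab⟩
      have h1 := hP i k hk
      have h2 := hP i l hl
      have : w i (k + 1) < w i l := hw i (Set.mem_Iic.2 h1.1) (Set.mem_Iic.2 (by omega))
        (by omega)
      have e := hs i ⟨(hws i l).1.trans hb.1, hb.2.trans (hws i (l + 1)).2⟩
        ⟨(hws i k).1.trans ha.1, ha.2.trans (hws i (k + 1)).2⟩ hab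
      linarith [ha.2, hb.1]
    rintro ⟨i, k, hk⟩ ⟨j, l, hl⟩ hne
    simp only [Γ, subMC_image]
    by_cases hij : i = j
    · subst hij
      rcases lt_trichotomy k l with h | h | h
      · exact lt_case i k l hk hl h
      · subst h; exact absurd rfl hne
      · exact (lt_case i l k hl hk h).symm
    · refine (hd i j hij).mono ?_ ?_
      · exact Set.image_mono (Set.Icc_subset_Icc (hws _ _).1 (hws _ _).2)
      · exact Set.image_mono (Set.Icc_subset_Icc (hws _ _).1 (hws _ _).2)

theorem stmt4 {X : Type*} [MetricSpace X] [CompleteSpace X] [ConnectedSpace X]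
    [MeasurableSpace X] [BorelSpace X]
    (h0 : 0 < μH[1] (Set.univ : Set X)) (h1 : μH[1] (Set.univ : Set X) < ⊤)
    (v : X → ℝ) :
    pVar v ≤ PVar v ∧ PVar v ≤ 2 * pVar v := by
  constructor
  · unfold pVar PVar
    refine iSup_mono fun n => iSup_mono fun γ => iSup_mono fun hs => iSup_mono fun hd =>
      Finset.sum_le_sum fun i _ => ?_
    have := eVariationOn.edist_le (v ∘ (γ i).toFun) (s := Set.Icc 0 (γ i).len)
      (Set.right_mem_Icc.2 (γ i).len_nonneg) (Set.left_mem_Icc.2 (γ i).len_nonneg)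
    rwa [edist_dist, Real.dist_eq] at this
  · conv_lhs => unfold PVar
    refine iSup_le fun n => iSup_le fun γ => iSup_le fun hs => iSup_le fun hd => ?_
    have point : ∀ (i : Fin n) (x : ℝ≥0∞),
        x < eVariationOn (v ∘ (γ i).toFun) (Set.Icc 0 (γ i).len) →
        ∃ p : ℕ × (ℕ → ℝ), (StrictMonoOn p.2 (Set.Iic p.1) ∧
          ∀ k, p.2 k ∈ Set.Icc 0 (γ i).len) ∧ x < ∑ k ∈ Finset.range p.1,
          edist ((v ∘ (γ i).toFun) (p.2 (k + 1))) ((v ∘ (γ i).toFun) (p.2 k)) := by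
      intro i x hx
      unfold eVariationOn at hx
      obtain ⟨⟨N, u, hu, hus⟩, hlt⟩ := lt_iSup_iff.1 hx
      obtain ⟨m, w, hw, hws, -, hsum⟩ := dedupe (f := v ∘ (γ i).toFun) u hu hus N
      exact ⟨(m, w), ⟨hw, hws⟩, by rw [← hsum]; exact hlt⟩
    classical
    let F : Fin n → ℕ × (ℕ → ℝ) → ℝ≥0∞ := fun i p =>
      ∑ k ∈ Finset.range p.1,
          edist ((v ∘ (γ i).toFun) (p.2 (k + 1))) ((v ∘ (γ i).toFun) (p.2 k))
    let Q : Fin n → ℕ × (ℕ → ℝ) → Prop := fun i p =>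
      StrictMonoOn p.2 (Set.Iic p.1) ∧ ∀ k, p.2 k ∈ Set.Icc 0 (γ i).len
    let G : Fin n → ℕ × (ℕ → ℝ) → ℝ≥0∞ := fun i p => if Q i p then F i p else 0
    have hG : ∀ i, eVariationOn (v ∘ (γ i).toFun) (Set.Icc 0 (γ i).len) ≤ ⨆ p, G i p := by
      intro i
      refine le_of_forall_lt fun x hx => ?_
      obtain ⟨p, hp, hlt⟩ := point i x hx
      refine lt_of_lt_of_le hlt (le_iSup_of_le p ?_)
      have hp' : Q i p := hp
      simp only [G, if_pos hp']
      exact le_rfl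
    refine (Finset.sum_le_sum fun i _ => hG i).trans ?_
    have := sum_iSup_le' G (2 * pVar v) Finset.univ 0 ?_
    · simpa using this
    intro c
    rw [zero_add]
    -- replace bad choices by trivial partitions
    let c' : Fin n → ℕ × (ℕ → ℝ) := fun i => if Q i (c i) then c i else (0, fun _ => 0)
    have hc' : ∀ i, Q i (c' i) := by
      intro i
      by_cases h : Q i (c i)
      · simpa only [c', if_pos h] using h
      · simp only [c', if_neg h]
        refine ⟨fun x hx y hy hxy => ?_, fun k => Set.left_mem_Icc.2 (γ i).len_nonneg⟩
        simp only [Set.mem_Iic] at hx hy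
        omega
    have hGc : ∀ i, G i (c i) = F i (c' i) := by
      intro i
      by_cases h : Q i (c i)
      · simp only [G, c', if_pos h]
      · simp only [G, c', if_neg h, F]
        simp
    simp only [hGc]
    have p0 := parity_le v γ hs hd (fun i => (c' i).1) (fun i => (c' i).2)
      (fun i => (hc' i).1) (fun i => (hc' i).2) 0
    have p1 := parity_le v γ hs hd (fun i => (c' i).1) (fun i => (c' i).2)
      (fun i => (hc' i).1) (fun i => (hc' i).2) 1
    rw [two_mul]
    refine le_trans (le_of_eq ?_) (add_le_add p0 p1)
    rw [← Finset.sum_add_distrib]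
    refine Finset.sum_congr rfl fun i _ => ?_
    simp only [F]
    rw [← Finset.sum_filter_add_sum_filter_not (Finset.range (c' i).1) (fun k => k % 2 = 0)]
    simp only [Nat.mod_two_ne_zero]
end

section
/- Let (X,d) be a complete and connected metric space with 0 < ℋ¹(X) < ∞. Let D ⊂ X with ℋ¹(X∖D) = 0 and let v : X → ℝ satisfy pV_D(v,X) < ∞. Then there exists a function v_e : X → ℝ with v_e = v on D and pV(v_e,X) = pV_D(v,X). -/
open MeasureTheory Set Filter Topology ENNReal

section helpers

variable {X : Type*} [MetricSpace X]

lemma mc_edist (γ : MCurve X) {s t : ℝ} (hs : s ∈ Icc 0 γ.len) (ht : t ∈ Icc 0 γ.len)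
    (hst : s ≤ t) : edist (γ.toFun s) (γ.toFun t) ≤ ENNReal.ofReal (t - s) := by
  rw [← γ.arclength s t hs ht hst]
  exact eVariationOn.edist_le _ ⟨le_rfl, hst⟩ ⟨hst, le_rfl⟩

lemma mc_dist (γ : MCurve X) {s t : ℝ} (hs : s ∈ Icc 0 γ.len) (ht : t ∈ Icc 0 γ.len) :
    dist (γ.toFun s) (γ.toFun t) ≤ |s - t| := by
  wlog h : s ≤ t generalizing s t
  · rw [dist_comm, abs_sub_comm]
    exact this ht hs (le_of_not_ge h)
  · have := mc_edist γ hs ht h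
    rw [edist_dist, ENNReal.ofReal_le_ofReal_iff (by linarith)] at this
    rw [abs_sub_comm, abs_of_nonneg (by linarith)]
    exact this

lemma mc_cont (γ : MCurve X) : ContinuousOn γ.toFun (Icc 0 γ.len) := by
  have : LipschitzOnWith 1 γ.toFun (Icc 0 γ.len) := by
    refine LipschitzOnWith.of_dist_le_mul ?_
    intro s hs t ht
    simpa [Real.dist_eq] using mc_dist γ hs ht
  exact this.continuousOn

lemma mc_compact (γ : MCurve X) : IsCompact γ.image :=
  isCompact_Icc.image_of_continuousOn (mc_cont γ)

lemma mc_sub (γ : MCurve X) (hγ : γ.IsSimple) {a b : ℝ} (ha : 0 ≤ a) (hab : a ≤ b)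
    (hb : b ≤ γ.len) : ∃ η : MCurve X, η.IsSimple ∧ η.len = b - a ∧
      (∀ u, η.toFun u = γ.toFun (a + u)) := by
  refine ⟨⟨b - a, by linarith, γ.toFun ∘ (fun u => a + u), ?_⟩, ?_, rfl, fun u => rfl⟩
  · intro s t hs ht hst
    rw [eVariationOn.comp_eq_of_monotoneOn _ _ (fun x _ y _ h => by simpa using h),
      image_const_add_Icc, γ.arclength _ _ ⟨by linarith [hs.1], by linarith [hs.2]⟩
        ⟨by linarith [ht.1], by linarith [ht.2]⟩ (by linarith)]
    congr 1; ring
  · intro s hs t ht h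
    have := hγ (x₁ := a + s) (x₂ := a + t) ⟨by linarith [hs.1], by linarith [hs.2]⟩
        ⟨by linarith [ht.1], by linarith [ht.2]⟩ h
    linarith

lemma mc_rev (γ : MCurve X) (hγ : γ.IsSimple) : ∃ η : MCurve X, η.IsSimple ∧ η.len = γ.len ∧
      (∀ u, η.toFun u = γ.toFun (γ.len - u)) ∧ η.image = γ.image := by
  refine ⟨⟨γ.len, γ.len_nonneg, γ.toFun ∘ (fun u => γ.len - u), ?_⟩, ?_, rfl, fun u => rfl, ?_⟩
  · intro s t hs ht hst
    rw [eVariationOn.comp_eq_of_antitoneOn _ _ (fun x _ y _ h => sub_le_sub_left h _),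
      image_const_sub_Icc, γ.arclength _ _ ⟨by linarith [ht.2], by linarith [ht.1]⟩
        ⟨by linarith [hs.2], by linarith [hs.1]⟩ (by linarith)]
    congr 1; ring
  · intro s hs t ht h
    have := hγ (x₁ := γ.len - s) (x₂ := γ.len - t) ⟨by linarith [hs.2], by linarith [hs.1]⟩
        ⟨by linarith [ht.2], by linarith [ht.1]⟩ h
    linarith
  · simp only [MCurve.image, image_comp, image_const_sub_Icc, sub_self, sub_zero]

lemma mc_path (β : MCurve X) (hβ : β.IsSimple) {δ t t' : ℝ} (hδ : δ ≤ β.len)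
    (ht : t ∈ Icc 0 δ) (ht' : t' ∈ Icc 0 δ) : ∃ η : MCurve X, η.IsSimple ∧
      η.toFun 0 = β.toFun t ∧ η.toFun η.len = β.toFun t' ∧ η.image ⊆ β.toFun '' Icc 0 δ := by
  wlog h : t ≤ t' generalizing t t'
  · obtain ⟨η, h1, h2, h3, h4⟩ := this ht' ht (le_of_not_ge h)
    obtain ⟨ζ, g1, g2, g3, g4⟩ := mc_rev η h1
    refine ⟨ζ, g1, ?_, ?_, g4 ▸ h4⟩
    · rw [g3, sub_zero, h3]
    · rw [g3, g2, sub_self, h2]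
  · obtain ⟨η, h1, h2, h3⟩ := mc_sub β hβ ht.1 h (ht'.2.trans hδ)
    refine ⟨η, h1, by rw [h3, add_zero], by rw [h3, h2]; congr 1; ring, ?_⟩
    rintro _ ⟨u, hu, rfl⟩
    rw [h2] at hu
    exact ⟨t + u, ⟨by linarith [ht.1, hu.1], by linarith [ht'.2, hu.2]⟩, (h3 u).symm⟩

lemma mc_concat (γ η : MCurve X) (hγ : γ.IsSimple) (hη : η.IsSimple)
    (hj : γ.toFun γ.len = η.toFun 0)
    (hd : ∀ s, 0 ≤ s → s < γ.len → γ.toFun s ∉ η.image) :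
    ∃ ζ : MCurve X, ζ.IsSimple ∧ ζ.len = γ.len + η.len ∧ ζ.toFun 0 = γ.toFun 0 ∧
      ζ.toFun ζ.len = η.toFun η.len ∧ ζ.image ⊆ γ.image ∪ η.image := by
  set L := γ.len with hL
  have hL0 : 0 ≤ L := γ.len_nonneg
  have hE0 : 0 ≤ η.len := η.len_nonneg
  let f : ℝ → X := fun u => if u ≤ L then γ.toFun u else η.toFun (u - L)
  have f1 : ∀ u, u ≤ L → f u = γ.toFun u := fun u hu => if_pos hu
  have f2 : ∀ u, L ≤ u → f u = η.toFun (u - L) := by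
    intro u hu
    rcases hu.eq_or_lt with h | h
    · rw [f1 u h.symm.le, ← h, sub_self, hj]
    · exact if_neg (not_le.2 h)
  have A : ∀ s t, 0 ≤ s → s ≤ t → t ≤ L → eVariationOn f (Icc s t) = ENNReal.ofReal (t - s) := by
    intro s t hs hst ht
    rw [← γ.arclength s t ⟨hs, hst.trans ht⟩ ⟨hs.trans hst, ht⟩ hst]
    exact eVariationOn.eq_of_eqOn fun u hu => f1 u (hu.2.trans ht)
  have B : ∀ s t, L ≤ s → s ≤ t → t ≤ L + η.len →
      eVariationOn f (Icc s t) = ENNReal.ofReal (t - s) := by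
    intro s t hs hst ht
    have : eVariationOn f (Icc s t) = eVariationOn (η.toFun ∘ (fun u => u - L)) (Icc s t) :=
      eVariationOn.eq_of_eqOn fun u hu => f2 u (hs.trans hu.1)
    rw [this, eVariationOn.comp_eq_of_monotoneOn _ _ (fun x _ y _ h => by simpa using h),
      image_sub_const_Icc, η.arclength _ _ ⟨by linarith, by linarith⟩
        ⟨by linarith, by linarith⟩ (by linarith)]
    congr 1; ring
  refine ⟨⟨L + η.len, by linarith, f, ?_⟩, ?_, rfl, f1 0 hL0, ?_, ?_⟩
  · intro s t hs ht hst
    by_cases h1 : t ≤ L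
    · exact A s t hs.1 hst h1
    by_cases h2 : L ≤ s
    · exact B s t h2 hst ht.2
    push Not at h1 h2
    have := eVariationOn.Icc_add_Icc f (s := univ) h2.le h1.le (mem_univ _)
    simp only [univ_inter] at this
    rw [← this, A s L hs.1 h2.le le_rfl, B L t le_rfl h1.le ht.2,
      ← ENNReal.ofReal_add (by linarith) (by linarith)]
    congr 1; ring
  · intro s hs t ht h
    change f s = f t at h
    simp only [mem_Icc] at hs ht
    wlog hst : s ≤ t generalizing s t
    · exact (this h.symm ht hs (le_of_not_ge hst)).symm
    by_cases h1 : t ≤ L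
    · rw [f1 s (hst.trans h1), f1 t h1] at h
      exact hγ ⟨hs.1, hst.trans h1⟩ ⟨ht.1, h1⟩ h
    by_cases h2 : L ≤ s
    · rw [f2 s h2, f2 t (h2.trans hst)] at h
      have := hη ⟨by linarith, by linarith⟩ ⟨by linarith, by linarith⟩ h
      linarith
    push Not at h1 h2
    rw [f1 s h2.le, f2 t h1.le] at h
    exact absurd ⟨t - L, ⟨by linarith, by linarith⟩, h.symm⟩ (hd s hs.1 h2)
  · change f (L + η.len) = _
    rw [f2 _ (by linarith)]; congr 1; ring
  · rintro _ ⟨u, hu, rfl⟩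
    change f u ∈ _
    simp only [mem_Icc] at hu
    rcases le_total u L with h | h
    · rw [f1 u h]; exact Or.inl ⟨u, ⟨hu.1, h⟩, rfl⟩
    · rw [f2 u h]; exact Or.inr ⟨u - L, ⟨by linarith, by linarith⟩, rfl⟩

lemma mc_dense [MeasurableSpace X] [BorelSpace X] (D : Set X) (hD : μH[1] Dᶜ = 0)
    (β : MCurve X) (hβ : β.IsSimple) {δ : ℝ} (h0 : 0 < δ) (hδ : δ ≤ β.len) :
    ∃ t, 0 < t ∧ t < δ ∧ β.toFun t ∈ D := by
  by_contra! hcon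
  set a := δ / 3 with ha
  set b := 2 * δ / 3 with hb
  have hab : a < b := by linarith
  have ham : a ∈ Icc 0 β.len := ⟨by linarith, by linarith⟩
  have hbm : b ∈ Icc 0 β.len := ⟨by linarith, by linarith⟩
  have hne : β.toFun a ≠ β.toFun b := fun h => hab.ne (hβ ham hbm h)
  have hnull : μH[1] (β.toFun '' Icc a b) = 0 := by
    refine measure_mono_null ?_ hD
    rintro _ ⟨t, ht, rfl⟩
    exact hcon t (by linarith [ht.1]) (by linarith [ht.2])
  let f : X → ℝ := fun y => dist y (β.toFun a)
  have hf : LipschitzWith 1 f := LipschitzWith.dist_left _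
  have h1 := hf.hausdorffMeasure_image_le (d := 1) zero_le_one (β.toFun '' Icc a b)
  rw [hnull, mul_zero, hausdorffMeasure_real] at h1
  have hc : ContinuousOn (f ∘ β.toFun) (Icc a b) :=
    hf.continuous.comp_continuousOn ((mc_cont β).mono (Icc_subset_Icc ham.1 hbm.2))
  have h2 : Icc 0 (dist (β.toFun b) (β.toFun a)) ⊆ f '' (β.toFun '' Icc a b) := by
    rw [← image_comp]
    have := intermediate_value_Icc hab.le hc
    simpa [f] using this
  have h3 := (measure_mono h2).trans h1
  rw [Real.volume_Icc, sub_zero, nonpos_iff_eq_zero, ENNReal.ofReal_eq_zero] at h3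
  exact absurd h3 (not_le.2 (dist_pos.2 hne.symm))

lemma pVarOn_ge (D : Set X) (v : X → ℝ) {ι : Type*} [Fintype ι] (γ : ι → MCurve X)
    (h1 : ∀ i, (γ i).IsSimple) (h2 : ∀ i j, i ≠ j → Disjoint (γ i).image (γ j).image)
    (h3 : ∀ i, (γ i).toFun 0 ∈ D ∧ (γ i).toFun (γ i).len ∈ D) :
    ∑ i, ENNReal.ofReal |v ((γ i).toFun (γ i).len) - v ((γ i).toFun 0)| ≤ pVarOn D v := by
  let e := Fintype.equivFin ι
  rw [← e.symm.sum_comp]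
  unfold pVarOn
  refine le_iSup_of_le (Fintype.card ι) (le_iSup_of_le (fun k => γ (e.symm k))
    (le_iSup_of_le (fun i => h1 _) (le_iSup_of_le (fun i j hij => h2 _ _ ?_)
      (le_iSup_of_le (fun i => h3 _) le_rfl))))
  simpa using hij

lemma mc_cluster [MeasurableSpace X] [BorelSpace X] (D : Set X) (hD : μH[1] Dᶜ = 0)
    (v : X → ℝ) (hv : pVarOn D v < ⊤) (β : MCurve X) (hβ : β.IsSimple) (hl : 0 < β.len) :
    ∃ c : ℝ, ∀ ε > 0, ∀ δ > 0, ∃ t, 0 < t ∧ t < δ ∧ t ≤ β.len ∧ β.toFun t ∈ D ∧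
      |v (β.toFun t) - c| < ε := by
  have hex : ∀ n : ℕ, ∃ t, 0 < t ∧ t < min β.len (1 / ((n : ℝ) + 1)) ∧ β.toFun t ∈ D := fun n =>
    mc_dense D hD β hβ (lt_min hl (by positivity)) (min_le_left _ _)
  choose t ht0 ht1 htD using hex
  have hmem : ∀ n, t n ∈ Icc 0 β.len := fun n => ⟨(ht0 n).le, (ht1 n).le.trans (min_le_left _ _)⟩
  have hb : ∀ n, v (β.toFun (t n)) ∈ Metric.closedBall (v (β.toFun (t 0))) (pVarOn D v).toReal := by
    intro n
    obtain ⟨η, g1, g2, g3, -⟩ := mc_path β hβ le_rfl (hmem 0) (hmem n)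
    have := pVarOn_ge D v (fun _ : Unit => η) (fun _ => g1) (fun i j h => absurd rfl h)
      (fun _ => ⟨by rw [g2]; exact htD 0, by rw [g3]; exact htD n⟩)
    simp only [Finset.univ_unique, Finset.sum_const, Finset.card_singleton, one_smul, g2, g3] at this
    rw [Metric.mem_closedBall, Real.dist_eq]
    exact (ENNReal.ofReal_le_iff_le_toReal hv.ne).1 this
  obtain ⟨c, -, φ, hφ, hlim⟩ := (isCompact_closedBall _ _).tendsto_subseq hb
  refine ⟨c, fun ε hε δ hδ => ?_⟩
  have e1 := Metric.tendsto_nhds.1 hlim ε hε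
  have e2 := (tendsto_one_div_add_atTop_nhds_zero_nat (𝕜 := ℝ)).comp hφ.tendsto_atTop
  have e3 := e2.eventually (gt_mem_nhds hδ)
  obtain ⟨n, h1, h2⟩ := (e1.and e3).exists
  exact ⟨t (φ n), ht0 _, ((ht1 _).trans_le (min_le_right _ _)).trans h2, (hmem _).2, htD _,
    by simpa [Real.dist_eq] using h1⟩

/-- `w` extends `v` by cluster values along curves. -/
def GoodExt (D : Set X) (v w : X → ℝ) : Prop :=
  (∀ x ∈ D, w x = v x) ∧ ∀ γ : MCurve X, γ.IsSimple → 0 < γ.len → γ.toFun 0 ∉ D →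
    ∃ β : MCurve X, β.IsSimple ∧ 0 < β.len ∧ β.toFun 0 = γ.toFun 0 ∧
      ∀ ε > 0, ∀ δ > 0, ∃ t, 0 < t ∧ t < δ ∧ t ≤ β.len ∧ β.toFun t ∈ D ∧
      |v (β.toFun t) - w (γ.toFun 0)| < ε

lemma exists_goodExt [MeasurableSpace X] [BorelSpace X] (D : Set X) (hD : μH[1] Dᶜ = 0)
    (v : X → ℝ) (hv : pVarOn D v < ⊤) : ∃ w, GoodExt D v w := by
  have key : ∀ x : X, ∃ c : ℝ, (x ∈ D → c = v x) ∧ (x ∉ D → ∀ γ : MCurve X, γ.IsSimple →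
      0 < γ.len → γ.toFun 0 = x → ∃ β : MCurve X, β.IsSimple ∧ 0 < β.len ∧ β.toFun 0 = x ∧
      ∀ ε > 0, ∀ δ > 0, ∃ t, 0 < t ∧ t < δ ∧ t ≤ β.len ∧ β.toFun t ∈ D ∧
      |v (β.toFun t) - c| < ε) := by
    intro x
    by_cases hx : x ∈ D
    · exact ⟨v x, fun _ => rfl, fun h => absurd hx h⟩
    by_cases h : ∃ γ : MCurve X, γ.IsSimple ∧ 0 < γ.len ∧ γ.toFun 0 = x
    · obtain ⟨β, b1, b2, b3⟩ := h
      obtain ⟨c, hc⟩ := mc_cluster D hD v hv β b1 b2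
      exact ⟨c, fun h => absurd h hx, fun _ _ _ _ _ => ⟨β, b1, b2, b3, hc⟩⟩
    · exact ⟨0, fun h => absurd h hx, fun _ γ g1 g2 g3 => absurd ⟨γ, g1, g2, g3⟩ h⟩
  choose w hw1 hw2 using key
  exact ⟨w, hw1, fun γ g1 g2 g3 => hw2 _ g3 γ g1 g2 rfl⟩

lemma mc_modify (D : Set X) (v w : X → ℝ) (hw : GoodExt D v w) (γ : MCurve X)
    (hγ : γ.IsSimple) (hl : 0 < γ.len) {r ε : ℝ} (hr : 0 < r) (hε : 0 < ε) :
    ∃ ζ : MCurve X, ζ.IsSimple ∧ 0 < ζ.len ∧ ζ.toFun 0 = γ.toFun 0 ∧ ζ.toFun ζ.len ∈ D ∧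
      ζ.image ⊆ Metric.thickening r γ.image ∧
      |v (ζ.toFun ζ.len) - w (γ.toFun γ.len)| < ε := by
  by_cases hxD : γ.toFun γ.len ∈ D
  · exact ⟨γ, hγ, hl, rfl, hxD, Metric.self_subset_thickening hr _, by
      rw [hw.1 _ hxD, sub_self, abs_zero]; exact hε⟩
  obtain ⟨ρ, p1, p2, p3, -⟩ := mc_rev γ hγ
  have hρ0 : ρ.toFun 0 = γ.toFun γ.len := by rw [p3, sub_zero]
  obtain ⟨β, b1, b2, b3, b4⟩ := hw.2 ρ p1 (p2 ▸ hl) (hρ0 ▸ hxD)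
  rw [hρ0] at b3 b4
  set x := γ.toFun γ.len with hx
  have m0 : (0 : ℝ) ∈ Icc 0 γ.len := ⟨le_rfl, hl.le⟩
  have ml : γ.len ∈ Icc 0 γ.len := ⟨hl.le, le_rfl⟩
  have hne : γ.toFun 0 ≠ x := fun h => hl.ne (hγ m0 ml h)
  have hdpos : 0 < dist (γ.toFun 0) x := dist_pos.2 hne
  obtain ⟨δ, hδ0, hδ⟩ := exists_between (lt_min b2 (lt_min hr hdpos))
  have hδl : δ ≤ β.len := (hδ.trans_le (min_le_left _ _)).le
  have hδr : δ < r := hδ.trans_le ((min_le_right _ _).trans (min_le_left _ _))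
  have hδd : δ < dist (γ.toFun 0) x := hδ.trans_le ((min_le_right _ _).trans (min_le_right _ _))
  set K := β.toFun '' Icc 0 δ with hK
  have hKx : ∀ y ∈ K, dist y x ≤ δ := by
    rintro _ ⟨t, ht, rfl⟩
    rw [← b3]
    refine (mc_dist β ⟨ht.1, ht.2.trans hδl⟩ ⟨le_rfl, b2.le⟩).trans ?_
    rw [sub_zero, abs_of_nonneg ht.1]; exact ht.2
  have hKc : IsCompact K :=
    isCompact_Icc.image_of_continuousOn ((mc_cont β).mono (Icc_subset_Icc le_rfl hδl))
  have hxK : x ∈ K := ⟨0, ⟨le_rfl, hδ0.le⟩, b3⟩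
  have hSc : IsCompact (Icc 0 γ.len ∩ γ.toFun ⁻¹' K) :=
    isCompact_Icc.of_isClosed_subset
      ((mc_cont γ).preimage_isClosed_of_isClosed isClosed_Icc hKc.isClosed) inter_subset_left
  obtain ⟨s, ⟨hs1, hs2⟩, hs3⟩ := hSc.exists_isLeast ⟨γ.len, ml, hxK⟩
  have hs0 : 0 < s := by
    rcases hs1.1.eq_or_lt with h | h
    · rw [← h] at hs2
      exact absurd (hKx _ hs2) (not_le.2 hδd)
    · exact h
  obtain ⟨t, ht, hts⟩ := hs2
  have hex : ∃ t', 0 < t' ∧ t' < δ ∧ β.toFun t' ∈ D ∧ |v (β.toFun t') - w x| < ε := by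
    obtain ⟨t', q1, q2, q3, q4, q5⟩ := b4 ε hε δ hδ0
    exact ⟨t', q1, q2, q4, q5⟩
  obtain ⟨t', q1, q2, q3, q4⟩ := hex
  obtain ⟨η, e1, e2, e3, e4⟩ := mc_path β b1 hδl ht ⟨q1.le, q2.le⟩
  obtain ⟨α, a1, a2, a3⟩ := mc_sub γ hγ le_rfl hs1.1 hs1.2
  rw [sub_zero] at a2
  simp only [zero_add] at a3
  obtain ⟨ζ, z1, z2, z3, z4, z5⟩ := mc_concat α η a1 e1 (by rw [a3, a2, e2, hts]) (by
    intro u hu0 hu1 hmem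
    rw [a2] at hu1
    rw [a3] at hmem
    exact absurd (hs3 ⟨⟨hu0, hu1.le.trans hs1.2⟩, e4 hmem⟩) (not_le.2 hu1))
  refine ⟨ζ, z1, ?_, by rw [z3, a3], by rw [z4, e3]; exact q3, ?_, by rw [z4, e3]; exact q4⟩
  · rw [z2, a2]; linarith [η.len_nonneg]
  · refine z5.trans (union_subset ?_ ?_)
    · refine Subset.trans ?_ (Metric.self_subset_thickening hr _)
      rintro _ ⟨u, hu, rfl⟩
      rw [a2] at hu
      exact ⟨u, ⟨hu.1, hu.2.trans hs1.2⟩, (a3 u).symm⟩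
    · intro y hy
      exact Metric.mem_thickening_iff.2 ⟨x, ⟨_, ml, rfl⟩, (hKx y (e4 hy)).trans_lt hδr⟩

lemma mc_modify2 (D : Set X) (v w : X → ℝ) (hw : GoodExt D v w) (γ : MCurve X)
    (hγ : γ.IsSimple) (hl : 0 < γ.len) {r ε : ℝ} (hr : 0 < r) (hε : 0 < ε) :
    ∃ ζ : MCurve X, ζ.IsSimple ∧ (ζ.toFun 0 ∈ D ∧ ζ.toFun ζ.len ∈ D) ∧
      ζ.image ⊆ Metric.thickening r γ.image ∧
      |w (γ.toFun γ.len) - w (γ.toFun 0)| ≤ |v (ζ.toFun ζ.len) - v (ζ.toFun 0)| + ε := by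
  obtain ⟨α, a1, a2, a3, a4, a5, a6⟩ := mc_modify D v w hw γ hγ hl (half_pos hr) (half_pos hε)
  obtain ⟨ρ, p1, p2, p3, p4⟩ := mc_rev α a1
  obtain ⟨ζ, z1, z2, z3, z4, z5, z6⟩ := mc_modify D v w hw ρ p1 (p2 ▸ a2) (half_pos hr) (half_pos hε)
  have h1 : ρ.toFun 0 = α.toFun α.len := by rw [p3, sub_zero]
  have h2 : ρ.toFun ρ.len = γ.toFun 0 := by rw [p3, p2, sub_self, a3]
  rw [h1] at z3
  rw [h2] at z6
  refine ⟨ζ, z1, ⟨z3 ▸ a4, z4⟩, ?_, ?_⟩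
  · refine z5.trans ?_
    rw [p4]
    refine (Metric.thickening_subset_of_subset _ a5).trans ?_
    refine (Metric.thickening_thickening_subset _ _ _).trans ?_
    rw [add_halves]
  · rw [z3]
    rw [abs_lt] at a6 z6
    rcases abs_cases (w (γ.toFun γ.len) - w (γ.toFun 0)) with h | h <;>
    rcases abs_cases (v (ζ.toFun ζ.len) - v (α.toFun α.len)) with h' | h' <;> linarith

lemma pVar_le_pVarOn (D : Set X) (v w : X → ℝ) (hw : GoodExt D v w) : pVar w ≤ pVarOn D v := by
  refine iSup_le fun n => iSup_le fun γ => iSup_le fun hs => iSup_le fun hd => ?_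
  have hr : ∃ r > 0, ∀ i j, i ≠ j →
      Disjoint (Metric.thickening r (γ i).image) (Metric.thickening r (γ j).image) := by
    have : ∀ p : Fin n × Fin n, ∃ r > 0, p.1 ≠ p.2 →
        Disjoint (Metric.thickening r (γ p.1).image) (Metric.thickening r (γ p.2).image) := by
      intro p
      by_cases h : p.1 = p.2
      · exact ⟨1, one_pos, fun h' => absurd h h'⟩
      · obtain ⟨r, h1, h2⟩ := (hd _ _ h).exists_thickenings (mc_compact _) (mc_compact _).isClosed
        exact ⟨r, h1, fun _ => h2⟩
    choose r hr0 hr using this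
    obtain ⟨q, hq0, hq⟩ : ∃ q > 0, ∀ p, q ≤ r p := by
      rcases isEmpty_or_nonempty (Fin n × Fin n) with h | h
      · exact ⟨1, one_pos, fun p => h.elim p⟩
      · obtain ⟨p, hp⟩ := Finite.exists_min r
        exact ⟨r p, hr0 p, hp⟩
    exact ⟨q, hq0, fun i j hij => (hr (i, j) hij).mono (Metric.thickening_mono (hq _) _)
      (Metric.thickening_mono (hq _) _)⟩
  obtain ⟨r, hr0, hr⟩ := hr
  refine ENNReal.le_of_forall_pos_le_add fun ε hε _ => ?_
  have hε' : (0 : ℝ) < ε / (n + 1) := by positivity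
  choose ζ z1 z2 z3 z4 using fun i : {i : Fin n // 0 < (γ i).len} =>
    mc_modify2 D v w hw (γ i) (hs i) i.2 hr0 hε'
  have hge := pVarOn_ge D v ζ z1 (fun i j hij =>
    (hr i j (fun h => hij (Subtype.ext h))).mono (z3 i) (z3 j)) z2
  set g : Fin n → ℝ≥0∞ := fun i =>
    ENNReal.ofReal |w ((γ i).toFun (γ i).len) - w ((γ i).toFun 0)| with hg
  have e1 : ∑ i, g i = ∑ i : {i : Fin n // 0 < (γ i).len}, g i := by
    rw [← Finset.sum_subtype (Finset.univ.filter fun i => 0 < (γ i).len) (by simp) g]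
    refine (Finset.sum_filter_of_ne fun i _ hi => ?_).symm
    refine lt_of_le_of_ne (γ i).len_nonneg fun h => hi ?_
    simp [hg, ← h]
  rw [e1]
  calc ∑ i : {i : Fin n // 0 < (γ i).len}, g i
      ≤ ∑ i, (ENNReal.ofReal |v ((ζ i).toFun (ζ i).len) - v ((ζ i).toFun 0)|
          + ENNReal.ofReal (ε / (n + 1))) := by
        refine Finset.sum_le_sum fun i _ => ?_
        rw [← ENNReal.ofReal_add (abs_nonneg _) hε'.le]
        exact ENNReal.ofReal_le_ofReal (z4 i)
    _ ≤ pVarOn D v + ε := by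
        rw [Finset.sum_add_distrib]
        refine add_le_add hge ?_
        rw [Finset.sum_const, nsmul_eq_mul, ← ENNReal.ofReal_natCast,
          ← ENNReal.ofReal_mul (Nat.cast_nonneg _), ← ENNReal.ofReal_coe_nnreal]
        refine ENNReal.ofReal_le_ofReal ?_
        have hc : ((Finset.univ : Finset {i : Fin n // 0 < (γ i).len}).card : ℝ) ≤ n + 1 := by
          have : (Finset.univ : Finset {i : Fin n // 0 < (γ i).len}).card ≤ n := by
            rw [Finset.card_univ]
            simpa using Fintype.card_subtype_le (fun i : Fin n => 0 < (γ i).len)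
          have : ((Finset.univ : Finset {i : Fin n // 0 < (γ i).len}).card : ℝ) ≤ n := by
            exact_mod_cast this
          linarith
        calc _ ≤ ((n : ℝ) + 1) * (ε / (n + 1)) := mul_le_mul_of_nonneg_right hc hε'.le
          _ = ε := by field_simp

lemma pVarOn_le_pVar (D : Set X) (v w : X → ℝ) (hw : ∀ x ∈ D, w x = v x) :
    pVarOn D v ≤ pVar w := by
  refine iSup_le fun n => iSup_le fun γ => iSup_le fun hs => iSup_le fun hd => iSup_le fun hD => ?_
  unfold pVar
  refine le_iSup_of_le n (le_iSup_of_le γ (le_iSup_of_le hs (le_iSup_of_le hd ?_)))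
  refine Finset.sum_le_sum fun i _ => ?_
  rw [hw _ (hD i).1, hw _ (hD i).2]

end helpers

theorem stmt5 {X : Type*} [MetricSpace X] [CompleteSpace X] [ConnectedSpace X]
    [MeasurableSpace X] [BorelSpace X]
    (h0 : 0 < μH[1] (Set.univ : Set X)) (h1 : μH[1] (Set.univ : Set X) < ⊤)
    (D : Set X) (hD : μH[1] Dᶜ = 0)
    (v : X → ℝ) (hv : pVarOn D v < ⊤) :
    ∃ ve : X → ℝ, (∀ x ∈ D, ve x = v x) ∧ pVar ve = pVarOn D v := by
  obtain ⟨w, hw⟩ := exists_goodExt D hD v hv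
  exact ⟨w, hw.1, le_antisymm (pVar_le_pVarOn D v w hw) (pVarOn_le_pVar D v w hw.1)⟩
end

section
/- Let (X,d) be a complete and connected metric space with 0 < ℋ¹(X) < ∞, equipped with the measure ℋ¹. If u : X → ℝ satisfies Var(u,X) < ∞, then there exists a good representative: a function ũ : X → ℝ with ũ = u ℋ¹-a.e. and pV(ũ,X) = Var(u,X), i.e. the infimum defining Var(u,X) is attained. -/
open MeasureTheory Set Filter Topology ENNReal

theorem MCurve.lipOn {X : Type*} [MetricSpace X] (γ : MCurve X) :
    LipschitzOnWith 1 γ.toFun (Set.Icc 0 γ.len) := by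
  have key : ∀ s ∈ Set.Icc 0 γ.len, ∀ t ∈ Set.Icc 0 γ.len, s ≤ t →
      edist (γ.toFun s) (γ.toFun t) ≤ edist s t := by
    intro s hs t ht hst
    have h := eVariationOn.edist_le γ.toFun (s := Set.Icc s t) (left_mem_Icc.2 hst)
      (right_mem_Icc.2 hst)
    rw [γ.arclength s t hs ht hst] at h
    rwa [edist_comm s t, edist_dist t s, Real.dist_eq, abs_of_nonneg (sub_nonneg.2 hst)]
  intro s hs t ht
  rw [ENNReal.coe_one, one_mul]
  rcases le_total s t with h | h
  · exact key s hs t ht h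
  · rw [edist_comm, edist_comm s t]
    exact key t ht s hs h

theorem MCurve.exists_mem {X : Type*} [MetricSpace X] [MeasurableSpace X] [BorelSpace X]
    (γ : MCurve X) (hγ : γ.IsSimple) (hl : 0 < γ.len) (D : Set X)
    (hD : (μH[1] : Measure X) Dᶜ = 0) : ∃ t ∈ Set.Icc 0 γ.len, γ.toFun t ∈ D := by
  by_contra! hcon
  have hsub : γ.image ⊆ Dᶜ := by
    rintro _ ⟨t, ht, rfl⟩
    exact hcon t ht
  have hnull : (μH[1] : Measure X) γ.image = 0 := measure_mono_null hsub hD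
  have hlip : LipschitzWith 1 (fun x => dist x (γ.toFun 0)) := LipschitzWith.dist_left _
  have h2 := hlip.hausdorffMeasure_image_le (d := 1) zero_le_one γ.image
  rw [hnull, mul_zero, hausdorffMeasure_real] at h2
  have hcont : ContinuousOn (fun s => dist (γ.toFun s) (γ.toFun 0)) (Set.Icc 0 γ.len) :=
    hlip.continuous.comp_continuousOn γ.lipOn.continuousOn
  have h3 := intermediate_value_Icc γ.len_nonneg hcont
  have h4 : Set.Icc 0 (dist (γ.toFun γ.len) (γ.toFun 0)) ⊆
      (fun x => dist x (γ.toFun 0)) '' γ.image := by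
    intro r hr
    obtain ⟨s, hs, rfl⟩ := h3 (by simpa using hr)
    exact ⟨γ.toFun s, ⟨s, hs, rfl⟩, rfl⟩
  have h5 := (measure_mono h4).trans h2
  rw [Real.volume_Icc, sub_zero] at h5
  have h6 : dist (γ.toFun γ.len) (γ.toFun 0) ≤ 0 := by
    simpa using h5
  have h7 := dist_le_zero.1 h6
  have := hγ (right_mem_Icc.2 γ.len_nonneg) (left_mem_Icc.2 γ.len_nonneg) h7
  exact hl.ne' this

theorem MCurve.le_pVar {X : Type*} [MetricSpace X] (v : X → ℝ) (γ : MCurve X)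
    (hγ : γ.IsSimple) (t : ℝ) (ht : t ∈ Set.Icc 0 γ.len) :
    ENNReal.ofReal |v (γ.toFun t) - v (γ.toFun 0)| ≤ pVar v := by
  have hss : Set.Icc 0 t ⊆ Set.Icc 0 γ.len := Set.Icc_subset_Icc_right ht.2
  let γ' : MCurve X := ⟨t, ht.1, γ.toFun, fun a b ha hb hab =>
    γ.arclength a b (hss ha) (hss hb) hab⟩
  have hs : γ'.IsSimple := hγ.mono hss
  unfold pVar
  refine le_trans ?_ (le_iSup_of_le 1 (le_iSup_of_le (fun _ => γ') (le_iSup_of_le (fun _ => hs)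
    (le_iSup_of_le (fun i j hij => absurd (Subsingleton.elim i j) hij) le_rfl))))
  simp [γ']

theorem exists_ultra_lim (a : ℕ → ℝ) (b C : ℝ) (h : ∀ k, |a k - b| ≤ C) :
    ∃ l, Tendsto a (hyperfilter ℕ : Filter ℕ) (𝓝 l) := by
  have hc : IsCompact (Metric.closedBall b C) := isCompact_closedBall b C
  obtain ⟨l, -, hl⟩ := hc.ultrafilter_le_nhds ((hyperfilter ℕ).map a) (by
    rw [le_principal_iff]
    change a ⁻¹' _ ∈ hyperfilter ℕ
    exact Filter.mem_of_superset univ_mem (fun k _ => by simpa [Real.dist_eq] using h k))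
  exact ⟨l, hl⟩

theorem stmt6 {X : Type*} [MetricSpace X] [CompleteSpace X] [ConnectedSpace X]
    [MeasurableSpace X] [BorelSpace X]
    (h0 : 0 < μH[1] (Set.univ : Set X)) (h1 : μH[1] (Set.univ : Set X) < ⊤)
    (u : X → ℝ) (hu : VarH (μH[1]) u < ⊤) :
    ∃ ut : X → ℝ, ut =ᵐ[(μH[1] : Measure X)] u ∧ pVar ut = VarH (μH[1]) u := by
  classical
  have hex : ∀ k : ℕ, ∃ v : X → ℝ, v =ᵐ[(μH[1] : Measure X)] u ∧
      pVar v ≤ VarH (μH[1]) u + ((k : ℝ≥0∞) + 1)⁻¹ := by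
    intro k
    have hlt : VarH (μH[1]) u < VarH (μH[1]) u + ((k : ℝ≥0∞) + 1)⁻¹ :=
      ENNReal.lt_add_right hu.ne (by simp)
    conv_lhs at hlt => unfold VarH
    simp only [iInf_lt_iff] at hlt
    obtain ⟨v, hv, h⟩ := hlt
    exact ⟨v, hv, h.le⟩
  choose v hv hpv using hex
  let D : Set X := {x | ∀ k, v k x = u x}
  have hDae : ∀ᵐ x ∂(μH[1] : Measure X), x ∈ D := ae_all_iff.2 hv
  have hD : (μH[1] : Measure X) Dᶜ = 0 := hDae
  let F : Filter ℕ := (hyperfilter ℕ : Filter ℕ)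
  have hF : F ≤ atTop := Nat.hyperfilter_le_atTop
  let ut : X → ℝ := fun x => if h : ∃ l, Tendsto (fun k => v k x) F (𝓝 l) then h.choose else u x
  have hut : ∀ x, (∃ l, Tendsto (fun k => v k x) F (𝓝 l)) →
      Tendsto (fun k => v k x) F (𝓝 (ut x)) := by
    intro x hx
    simp only [ut, dif_pos hx]
    exact hx.choose_spec
  have hutD : ∀ x ∈ D, ut x = u x := by
    intro x hx
    have hc : Tendsto (fun k => v k x) F (𝓝 (u x)) := by
      have : (fun k => v k x) = fun _ => u x := funext hx
      rw [this]; exact tendsto_const_nhds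
    exact tendsto_nhds_unique (hut x ⟨_, hc⟩) hc
  have hae : ut =ᵐ[(μH[1] : Measure X)] u := hDae.mono hutD
  refine ⟨ut, hae, le_antisymm ?_ (iInf₂_le ut hae)⟩
  -- uniform bound
  set C : ℝ := (VarH (μH[1]) u + 1).toReal with hC
  have hVt : VarH (μH[1]) u + 1 ≠ ⊤ := by simp [hu.ne]
  have hb : ∀ k, pVar (v k) ≤ VarH (μH[1]) u + 1 := fun k =>
    (hpv k).trans (by gcongr; simp)
  have hosc : ∀ (γ : MCurve X), γ.IsSimple → ∀ t ∈ Set.Icc 0 γ.len, ∀ k,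
      |v k (γ.toFun t) - v k (γ.toFun 0)| ≤ C := by
    intro γ hγ t ht k
    exact (ENNReal.ofReal_le_iff_le_toReal hVt).1 ((γ.le_pVar (v k) hγ t ht).trans (hb k))
  have hlim : ∀ γ : MCurve X, γ.IsSimple →
      Tendsto (fun k => ENNReal.ofReal |v k (γ.toFun γ.len) - v k (γ.toFun 0)|) F
        (𝓝 (ENNReal.ofReal |ut (γ.toFun γ.len) - ut (γ.toFun 0)|)) := by
    intro γ hγ
    rcases γ.len_nonneg.eq_or_lt with hl | hl
    · rw [← hl]; simp
    obtain ⟨t, ht, htD⟩ := γ.exists_mem hγ hl D hD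
    have e0 : ∃ l, Tendsto (fun k => v k (γ.toFun 0)) F (𝓝 l) := by
      refine exists_ultra_lim _ (u (γ.toFun t)) C fun k => ?_
      rw [abs_sub_comm, ← htD k]
      exact hosc γ hγ t ht k
    have e1 : ∃ l, Tendsto (fun k => v k (γ.toFun γ.len)) F (𝓝 l) := by
      refine exists_ultra_lim _ (u (γ.toFun t)) (C + C) fun k => ?_
      have a1 := hosc γ hγ t ht k
      have a2 := hosc γ hγ γ.len (right_mem_Icc.2 γ.len_nonneg) k
      rw [← htD k]
      rw [abs_le] at *
      constructor <;> linarith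
    exact ENNReal.tendsto_ofReal ((hut _ e1).sub (hut _ e0)).abs
  unfold pVar
  refine iSup_le fun n => iSup_le fun γ => iSup_le fun hs => iSup_le fun hd => ?_
  have hl := tendsto_finsetSum (Finset.univ : Finset (Fin n)) fun i _ => hlim (γ i) (hs i)
  have hr : Tendsto (fun k : ℕ => VarH (μH[1]) u + ((k : ℝ≥0∞) + 1)⁻¹) F
      (𝓝 (VarH (μH[1]) u)) := by
    have h := (tendsto_add_atTop_iff_nat 1).2 ENNReal.tendsto_inv_nat_nhds_zero
    have h' := (tendsto_const_nhds (x := VarH (μH[1]) u)).add h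
    simp only [add_zero, Nat.cast_add, Nat.cast_one] at h'
    exact h'.mono_left hF
  refine le_of_tendsto_of_tendsto' hl hr fun k => le_trans ?_ (hpv k)
  exact le_iSup_of_le n (le_iSup_of_le γ (le_iSup_of_le hs (le_iSup_of_le hd le_rfl)))
end

section
/- Let (X,d) be a complete and connected metric space with 0 < ℋ¹(X) < ∞. Every curve-continuous function v : X → ℝ is ℋ¹-measurable. -/
open MeasureTheory Set Filter Topology ENNReal

/-- A function is curve-continuous if it is continuous along every curve in `X`. -/
def CurveContinuous {X : Type*} [MetricSpace X] (v : X → ℝ) : Prop :=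
  ∀ γ : MCurve X, ContinuousOn (v ∘ γ.toFun) (Set.Icc 0 γ.len)

theorem aux_ball_measure {X : Type*} [MetricSpace X] [ConnectedSpace X]
    [MeasurableSpace X] [BorelSpace X] (x y : X) (r : ℝ) (hr : r ≤ dist y x) :
    ENNReal.ofReal r ≤ μH[1] (Metric.ball x r) := by
  have hlip : LipschitzWith 1 (fun z : X => dist z x) := LipschitzWith.dist_left x
  have h := hlip.hausdorffMeasure_image_le (d := 1) zero_le_one (Metric.ball x r)
  have hsub : Set.Ico 0 r ⊆ (fun z : X => dist z x) '' Metric.ball x r := by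
    rintro t ⟨h0, h1⟩
    have hp := isPreconnected_univ.intermediate_value (mem_univ x) (mem_univ y)
      (f := fun z : X => dist z x) hlip.continuous.continuousOn
    obtain ⟨z, -, hz⟩ := hp (show t ∈ Set.Icc _ _ from ⟨by simpa using h0, (h1.le.trans hr)⟩)
    exact ⟨z, by simpa [Metric.mem_ball, hz] using (show dist z x < r by simpa [← hz] using h1), hz⟩
  have h2 : ENNReal.ofReal r ≤ μH[1] ((fun z : X => dist z x) '' Metric.ball x r) := by
    rw [hausdorffMeasure_real]
    calc ENNReal.ofReal r = volume (Set.Ico 0 r) := by simp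
      _ ≤ _ := measure_mono hsub
  simpa using h2.trans h

theorem aux_card {X : Type*} [MetricSpace X] [ConnectedSpace X]
    [MeasurableSpace X] [BorelSpace X] (h1 : μH[1] (Set.univ : Set X) < ⊤)
    (ε : ℝ) (hε : 0 < ε) (S : Finset X) (hS : ∀ x ∈ S, ∀ y ∈ S, x ≠ y → ε ≤ dist x y) :
    (S.card : ℝ) * ε ≤ 2 * (μH[1] (Set.univ : Set X)).toReal + ε := by
  rcases le_or_gt S.card 1 with hc | hc
  · have : (S.card : ℝ) ≤ 1 := by exact_mod_cast hc
    have h2 : 0 ≤ (μH[1] (Set.univ : Set X)).toReal := ENNReal.toReal_nonneg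
    nlinarith
  · have hd : (S : Set X).PairwiseDisjoint (fun x => Metric.ball x (ε/2)) := by
      intro x hx y hy hxy
      apply Metric.ball_disjoint_ball
      have := hS x hx y hy hxy
      linarith
    have hm := measure_biUnion_finset (μ := (μH[1] : Measure X)) hd
      (fun x _ => Metric.isOpen_ball.measurableSet)
    have hle : ∑ x ∈ S, ENNReal.ofReal (ε/2) ≤ μH[1] (Set.univ : Set X) := by
      refine le_trans (Finset.sum_le_sum fun x hx => ?_) (hm.symm.le.trans (measure_mono (subset_univ _)))
      obtain ⟨y, hy, hyx⟩ := Finset.exists_mem_ne hc x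
      have := hS y hy x hx hyx
      exact aux_ball_measure x y _ (by linarith)
    have h3 := ENNReal.toReal_mono h1.ne hle
    rw [Finset.sum_const, nsmul_eq_mul, ENNReal.toReal_mul, ENNReal.toReal_ofReal (by linarith)] at h3
    simp at h3
    linarith

theorem aux_net {X : Type*} [MetricSpace X] [ConnectedSpace X]
    [MeasurableSpace X] [BorelSpace X] (h1 : μH[1] (Set.univ : Set X) < ⊤)
    (ε : ℝ) (hε : 0 < ε) : ∃ S : Finset X, S.Nonempty ∧
    (S.card : ℝ) * ε ≤ 2 * (μH[1] (Set.univ : Set X)).toReal + ε ∧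
    ∀ x, ∃ y ∈ S, dist x y < ε := by
  classical
  set P : ℕ → Prop := fun n => ∃ S : Finset X,
    (∀ x ∈ S, ∀ y ∈ S, x ≠ y → ε ≤ dist x y) ∧ S.card = n with hP
  set M := (2 * (μH[1] (Set.univ : Set X)).toReal + ε) / ε
  have hb : ∀ n, P n → n ≤ ⌊M⌋₊ := by
    rintro n ⟨S, hS, rfl⟩
    apply Nat.le_floor
    rw [le_div_iff₀ hε]
    exact aux_card h1 ε hε S hS
  have hP0 : P 0 := ⟨∅, by simp, by simp⟩
  obtain ⟨S, hS, hc⟩ := Nat.findGreatest_spec (P := P) (Nat.zero_le ⌊M⌋₊) hP0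
  have hdense : ∀ x, ∃ y ∈ S, dist x y < ε := by
    intro x
    by_contra! hx
    have hxS : x ∉ S := fun h => by have := hx x h; simp at this; linarith
    have : P (S.card + 1) := by
      refine ⟨insert x S, ?_, Finset.card_insert_of_notMem hxS⟩
      intro a ha b hb hab
      rw [Finset.mem_insert] at ha hb
      rcases ha with rfl | ha <;> rcases hb with rfl | hb
      · exact absurd rfl hab
      · exact hx b hb
      · rw [dist_comm]; exact hx a ha
      · exact hS a ha b hb hab
    have h2 := Nat.le_findGreatest (hb _ this) this
    omega
  refine ⟨S, ?_, aux_card h1 ε hε S hS, hdense⟩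
  obtain ⟨x⟩ : Nonempty X := inferInstance
  obtain ⟨y, hy, -⟩ := hdense x
  exact ⟨y, hy⟩

theorem aux_walk {X : Type*} [MetricSpace X] [ConnectedSpace X]
    (ε : ℝ) (hε : 0 < ε) (S : Finset X) (hd : ∀ x, ∃ y ∈ S, dist x y < ε) (n : ℕ) :
    n < S.card → ∃ T ⊆ S, T.card = n + 1 ∧ ∃ w : ℕ → X, (∀ k, dist (w k) (w (k+1)) ≤ 2 * ε) ∧
      ∀ t ∈ T, ∃ k < 2 * n + 1, w k = t := by
  classical
  induction n with
  | zero =>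
    intro h
    obtain ⟨x, hx⟩ := Finset.card_pos.1 h
    refine ⟨{x}, by simpa using hx, by simp, fun _ => x, fun k => by simp; linarith, ?_⟩
    intro t ht
    exact ⟨0, by simp, (Finset.mem_singleton.1 ht).symm⟩
  | succ n ih =>
    intro h
    obtain ⟨T, hTS, hTc, w, hw, hcov⟩ := ih (by omega)
    obtain ⟨t, ht, s, hs, hts⟩ : ∃ t ∈ T, ∃ s ∈ S \ T, dist t s ≤ 2 * ε := by
      have hA : IsClosed (⋃ t ∈ T, Metric.closedBall t ε) :=
        T.finite_toSet.isClosed_biUnion fun _ _ => Metric.isClosed_closedBall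
      have hB : IsClosed (⋃ t ∈ S \ T, Metric.closedBall t ε) :=
        (S \ T).finite_toSet.isClosed_biUnion fun _ _ => Metric.isClosed_closedBall
      have hpc := isPreconnected_closed_iff.1 (isPreconnected_univ (α := X)) _ _ hA hB
      have hcover : (Set.univ : Set X) ⊆ (⋃ t ∈ T, Metric.closedBall t ε) ∪
          (⋃ t ∈ S \ T, Metric.closedBall t ε) := by
        intro x _
        obtain ⟨y, hy, hxy⟩ := hd x
        by_cases hyT : y ∈ T
        · left; exact mem_biUnion hyT (Metric.mem_closedBall.2 hxy.le)
        · right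
          exact mem_biUnion (show y ∈ S \ T from Finset.mem_sdiff.2 ⟨hy, hyT⟩)
            (Metric.mem_closedBall.2 hxy.le)
      obtain ⟨a, ha⟩ : T.Nonempty := Finset.card_pos.1 (by omega)
      obtain ⟨b, hb⟩ : (S \ T).Nonempty := by
        apply Finset.card_pos.1
        rw [Finset.card_sdiff_of_subset hTS]; omega
      obtain ⟨z, -, hz1, hz2⟩ := hpc hcover
        ⟨a, mem_univ _, mem_biUnion ha (Metric.mem_closedBall_self hε.le)⟩
        ⟨b, mem_univ _, mem_biUnion hb (Metric.mem_closedBall_self hε.le)⟩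
      simp only [mem_iUnion, Metric.mem_closedBall] at hz1 hz2
      obtain ⟨t, ht, h1⟩ := hz1
      obtain ⟨s, hs, h2⟩ := hz2
      refine ⟨t, ht, s, hs, ?_⟩
      have := dist_triangle_left t s z
      linarith
    obtain ⟨j, hj, hjt⟩ := hcov t ht
    have hs' := Finset.mem_sdiff.1 hs
    refine ⟨insert s T, Finset.insert_subset hs'.1 hTS,
      by rw [Finset.card_insert_of_notMem hs'.2, hTc],
      fun k => if k ≤ j then w k else if k = j + 1 then s else w (k - 2), ?_, ?_⟩
    · intro k
      rcases lt_trichotomy k j with hk | rfl | hk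
      · simp only [hk.le, if_true, show k + 1 ≤ j from hk]; exact hw k
      · simpa [hjt] using hts
      · by_cases hk1 : k = j + 1
        · subst hk1
          simp [hjt, dist_comm, hts]
        · have e1 : ¬ k ≤ j := by omega
          have e2 : ¬ k + 1 ≤ j := by omega
          have e3 : ¬ k + 1 = j + 1 := by omega
          simp only [e1, e2, e3, hk1, if_false]
          have := hw (k - 2)
          rwa [show k - 2 + 1 = k + 1 - 2 by omega] at this
    · intro a ha
      rcases Finset.mem_insert.1 ha with rfl | ha
      · exact ⟨j + 1, by omega, by simp⟩
      · obtain ⟨k, hk, hka⟩ := hcov a ha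
        by_cases hkj : k ≤ j
        · exact ⟨k, by omega, by simp [hkj, hka]⟩
        · refine ⟨k + 2, by omega, ?_⟩
          have e2 : ¬ k + 2 ≤ j := by omega
          have e3 : ¬ k + 2 = j + 1 := by omega
          simp only [e2, e3, if_false]
          simpa using hka

theorem aux_floor (a b : ℝ) (hab : a ≤ b) : (⌊b⌋₊ : ℝ) - ⌊a⌋₊ ≤ b - a + 1 := by
  rcases le_or_gt 0 b with hb | hb
  · have h1 := Nat.floor_le hb
    have h2 := Nat.lt_floor_add_one a
    linarith
  · rw [Nat.floor_of_nonpos hb.le, Nat.floor_of_nonpos (by linarith)]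
    simp; linarith

theorem aux_coarse {X : Type*} [MetricSpace X] [ConnectedSpace X]
    [MeasurableSpace X] [BorelSpace X] (h1 : μH[1] (Set.univ : Set X) < ⊤)
    (ε : ℝ) (hε : 0 < ε) (hε1 : ε ≤ 1) : ∃ F : ℝ → X,
    (∀ s t, dist (F s) (F t) ≤ (8 * (μH[1] (Set.univ : Set X)).toReal + 4) * |s - t| + 2 * ε) ∧
    ∀ x, ∃ t ∈ Set.Icc (0:ℝ) 1, dist x (F t) < ε := by
  obtain ⟨S, hne, hcard, hd⟩ := aux_net h1 ε hε
  have hpos := Finset.card_pos.2 hne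
  obtain ⟨T, hTS, hTc, w, hw, hcov⟩ := aux_walk ε hε S hd (S.card - 1) (by omega)
  have hT : T = S := Finset.eq_of_subset_of_card_le hTS (by omega)
  subst hT
  set m : ℕ := 2 * (T.card - 1) + 1 with hm
  have hm0 : (0:ℝ) < m := by exact_mod_cast (by omega : 0 < m)
  have hmle : (m : ℝ) * ε ≤ 4 * (μH[1] (Set.univ : Set X)).toReal + 2 := by
    have h2 : (m : ℝ) = 2 * T.card - 1 := by
      have : m + 1 = 2 * T.card := by omega
      have : (m : ℝ) + 1 = 2 * T.card := by exact_mod_cast this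
      linarith
    rw [h2]; nlinarith
  have hwd : ∀ i j, i ≤ j → dist (w i) (w j) ≤ 2 * ε * ((j:ℝ) - i) := by
    intro i j hij
    have := dist_le_Ico_sum_of_dist_le (f := w) hij (d := fun _ => 2 * ε) (fun _ _ => hw _)
    simp only [Finset.sum_const, Nat.card_Ico, nsmul_eq_mul] at this
    rw [Nat.cast_sub hij] at this
    linarith
  have key : ∀ s t : ℝ, s ≤ t → dist (w ⌊s * m⌋₊) (w ⌊t * m⌋₊) ≤
      (8 * (μH[1] (Set.univ : Set X)).toReal + 4) * |s - t| + 2 * ε := by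
    intro s t hst
    have hst' : s * m ≤ t * m := by gcongr
    have h2 := hwd _ _ (Nat.floor_mono hst')
    have h3 := aux_floor _ _ hst'
    rw [abs_sub_comm, abs_of_nonneg (by linarith : 0 ≤ t - s)]
    have h4 : 2 * ε * ((⌊t * m⌋₊ : ℝ) - ⌊s * m⌋₊) ≤ 2 * ε * (t * m - s * m + 1) := by gcongr
    have h5 := mul_le_mul_of_nonneg_right hmle (by linarith : 0 ≤ t - s)
    nlinarith
  refine ⟨fun t => w ⌊t * m⌋₊, ?_, ?_⟩
  · intro s t
    rcases le_total s t with h | h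
    · exact key s t h
    · rw [dist_comm, abs_sub_comm]; exact key t s h
  · intro x
    obtain ⟨y, hy, hxy⟩ := hd x
    obtain ⟨k, hk, hky⟩ := hcov y hy
    have hk' : (k : ℝ) ≤ m := by exact_mod_cast hk.le
    refine ⟨k / m, ⟨by positivity, by rw [div_le_one hm0]; exact hk'⟩, ?_⟩
    simp only
    rw [div_mul_cancel₀ _ hm0.ne', Nat.floor_natCast, hky]
    exact hxy

theorem aux_compact {X : Type*} [MetricSpace X] [CompleteSpace X] [ConnectedSpace X]
    [MeasurableSpace X] [BorelSpace X] (h1 : μH[1] (Set.univ : Set X) < ⊤) :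
    CompactSpace X := by
  refine ⟨isCompact_iff_totallyBounded_isComplete.2 ⟨?_, completeSpace_iff_isComplete_univ.1 inferInstance⟩⟩
  rw [Metric.totallyBounded_iff]
  intro ε hε
  obtain ⟨S, -, -, hd⟩ := aux_net h1 ε hε
  refine ⟨S, S.finite_toSet, fun x _ => ?_⟩
  obtain ⟨y, hy, hxy⟩ := hd x
  exact mem_biUnion hy hxy

theorem aux_lipschitz {X : Type*} [MetricSpace X] [CompleteSpace X] [ConnectedSpace X]
    [MeasurableSpace X] [BorelSpace X] (h1 : μH[1] (Set.univ : Set X) < ⊤) :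
    ∃ (L : NNReal) (f : ℝ → X), LipschitzWith L f ∧ ∀ x, ∃ t ∈ Set.Icc (0:ℝ) 1, f t = x := by
  have := aux_compact h1
  set L : ℝ := 8 * (μH[1] (Set.univ : Set X)).toReal + 4 with hL
  have hL0 : 0 ≤ L := by positivity
  have hF := fun n : ℕ => aux_coarse h1 (1 / ((n:ℝ) + 1)) (by positivity)
    (by rw [div_le_one (by positivity)]; linarith [(Nat.cast_nonneg n : (0:ℝ) ≤ n)])
  choose F hFL hFd using hF
  let u : Ultrafilter ℕ := hyperfilter ℕ
  have hu : Tendsto (fun n : ℕ => 1 / ((n:ℝ) + 1)) u (𝓝 0) :=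
    tendsto_one_div_add_atTop_nhds_zero_nat.mono_left Nat.hyperfilter_le_atTop
  have hlim : ∀ t, ∃ x, Tendsto (fun n => F n t) u (𝓝 x) := by
    intro t
    obtain ⟨x, -, hx⟩ := isCompact_univ.ultrafilter_le_nhds (u.map fun n => F n t) (by simp)
    exact ⟨x, hx⟩
  choose f hf using hlim
  refine ⟨⟨L, hL0⟩, f, ?_, ?_⟩
  · refine LipschitzWith.of_dist_le_mul fun s t => ?_
    have h2 : Tendsto (fun n : ℕ => L * |s - t| + 2 * (1 / ((n:ℝ) + 1))) u
        (𝓝 (L * |s - t| + 2 * 0)) := tendsto_const_nhds.add (hu.const_mul 2)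
    have := le_of_tendsto_of_tendsto' ((hf s).dist (hf t)) h2 (fun n => hFL n s t)
    rw [mul_zero, add_zero] at this
    rw [Real.dist_eq]
    exact this
  · intro x
    choose T hT hTx using fun n => hFd n x
    obtain ⟨t, ht, htu⟩ := isCompact_Icc.ultrafilter_le_nhds (s := Set.Icc (0:ℝ) 1) (u.map T)
      (by
        simp only [Filter.le_principal_iff, Ultrafilter.mem_coe, Ultrafilter.mem_map]
        exact Filter.mem_of_superset Filter.univ_mem fun n _ => hT n)
    have htu' : Tendsto T u (𝓝 t) := htu
    refine ⟨t, ht, ?_⟩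
    have h3 : Tendsto (fun n : ℕ => 1 / ((n:ℝ) + 1) + (L * |T n - t| + 2 * (1 / ((n:ℝ) + 1)))) u
        (𝓝 (0 + (L * |t - t| + 2 * 0))) :=
      hu.add (((htu'.sub_const t).abs.const_mul L).add (hu.const_mul 2))
    have h4 : dist x (f t) ≤ 0 + (L * |t - t| + 2 * 0) :=
      le_of_tendsto_of_tendsto' (tendsto_const_nhds.dist (hf t)) h3 (fun n => by
        have := dist_triangle x (F n (T n)) (F n t)
        have a := hTx n
        have b := hFL n (T n) t
        linarith)
    simp at h4
    exact h4.symm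

theorem aux_curve {X : Type*} [MetricSpace X] (L : NNReal) (f : ℝ → X) (hf : LipschitzWith L f) :
    ∃ γ : MCurve X, ∀ t ∈ Set.Icc (0:ℝ) 1, ∃ s ∈ Set.Icc 0 γ.len, γ.toFun s = f t := by
  have hbv : LocallyBoundedVariationOn f (Set.Icc (0:ℝ) 1) :=
    (hf.lipschitzOnWith (s := Set.Icc (0:ℝ) 1)).locallyBoundedVariationOn
  have z : (0:ℝ) ∈ Set.Icc (0:ℝ) 1 := by simp
  have o : (1:ℝ) ∈ Set.Icc (0:ℝ) 1 := by simp
  set V := variationOnFromTo f (Set.Icc (0:ℝ) 1) 0 with hV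
  have hmono : MonotoneOn V (Set.Icc (0:ℝ) 1) := variationOnFromTo.monotoneOn hbv z
  have hV0 : V 0 = 0 := variationOnFromTo.self _ _ _
  have hinc : ∀ a ∈ Set.Icc (0:ℝ) 1, ∀ b ∈ Set.Icc (0:ℝ) 1, a ≤ b → V b - V a ≤ L * (b - a) := by
    intro a ha b hb hab
    have e : V b - V a = variationOnFromTo f (Set.Icc (0:ℝ) 1) a b := by
      have := variationOnFromTo.add hbv z ha hb
      simp only [hV]; linarith
    rw [e, variationOnFromTo.eq_of_le _ _ hab]
    have h1 := (hf.lipschitzOnWith (s := Set.univ)).comp_eVariationOn_le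
      (f := f) (g := (id : ℝ → ℝ)) (s := Set.Icc (0:ℝ) 1 ∩ Set.Icc a b) (fun _ _ => mem_univ _)
    have h2 : eVariationOn (id : ℝ → ℝ) (Set.Icc (0:ℝ) 1 ∩ Set.Icc a b) ≤ ENNReal.ofReal (b - a) :=
      (monotone_id.monotoneOn (Set.Icc (0:ℝ) 1)).eVariationOn_eq ha hb |>.le
    have h3 : eVariationOn f (Set.Icc (0:ℝ) 1 ∩ Set.Icc a b) ≤ L * ENNReal.ofReal (b - a) :=
      le_trans h1 (by gcongr)
    have h4 := ENNReal.toReal_mono (ENNReal.mul_ne_top ENNReal.coe_ne_top ENNReal.ofReal_ne_top) h3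
    rwa [ENNReal.toReal_mul, ENNReal.toReal_ofReal (by linarith), ENNReal.coe_toReal] at h4
  have hcont : ContinuousOn V (Set.Icc (0:ℝ) 1) := by
    refine (LipschitzOnWith.of_dist_le_mul (K := L) ?_).continuousOn
    have key : ∀ a ∈ Set.Icc (0:ℝ) 1, ∀ b ∈ Set.Icc (0:ℝ) 1, a ≤ b → dist (V a) (V b) ≤ L * dist a b := by
      intro a ha b hb hab
      rw [dist_comm, dist_comm a, Real.dist_eq, Real.dist_eq, abs_of_nonneg (by linarith [hmono ha hb hab]),
        abs_of_nonneg (by linarith)]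
      exact hinc a ha b hb hab
    intro a ha b hb
    rcases le_total a b with h | h
    · exact key a ha b hb h
    · rw [dist_comm, dist_comm a]; exact key b hb a ha h
  have himg : V '' Set.Icc (0:ℝ) 1 = Set.Icc 0 (V 1) := by
    apply Set.Subset.antisymm
    · rintro _ ⟨t, ht, rfl⟩
      exact ⟨hV0 ▸ hmono z ht ht.1, hmono ht o ht.2⟩
    · have := intermediate_value_Icc zero_le_one hcont
      rwa [hV0] at this
  have hus := has_unit_speed_naturalParameterization f hbv z
  rw [← hV, himg] at hus
  refine ⟨⟨V 1, hV0 ▸ hmono z o zero_le_one, naturalParameterization f (Set.Icc (0:ℝ) 1) 0, ?_⟩, ?_⟩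
  · intro s t hs ht hst
    have := hus hs ht
    rwa [Set.inter_eq_right.2 (Set.Icc_subset_Icc hs.1 ht.2), NNReal.coe_one, one_mul] at this
  · intro t ht
    exact ⟨V t, himg ▸ mem_image_of_mem V ht,
      edist_eq_zero.1 (edist_naturalParameterization_eq_zero hbv z ht)⟩

theorem aux_curve_cont {X : Type*} [MetricSpace X] (γ : MCurve X) :
    ContinuousOn γ.toFun (Set.Icc 0 γ.len) := by
  refine (show LipschitzOnWith 1 γ.toFun (Set.Icc 0 γ.len) from ?_).continuousOn
  have key : ∀ a ∈ Set.Icc 0 γ.len, ∀ b ∈ Set.Icc 0 γ.len, a ≤ b →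
      edist (γ.toFun a) (γ.toFun b) ≤ edist a b := by
    intro a ha b hb hab
    have h1 := γ.arclength a b ha hb hab
    have h2 := eVariationOn.edist_le γ.toFun (s := Set.Icc a b) (left_mem_Icc.2 hab) (right_mem_Icc.2 hab)
    rw [h1] at h2
    rw [edist_comm a, edist_dist b a, Real.dist_eq, abs_of_nonneg (by linarith)]
    exact h2
  intro a ha b hb
  simp only [ENNReal.coe_one, one_mul]
  rcases le_total a b with h | h
  · exact key a ha b hb h
  · rw [edist_comm, edist_comm a]; exact key b hb a ha h

theorem stmt9 {X : Type*} [MetricSpace X] [CompleteSpace X] [ConnectedSpace X]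
    [MeasurableSpace X] [BorelSpace X]
    (h0 : 0 < μH[1] (Set.univ : Set X)) (h1 : μH[1] (Set.univ : Set X) < ⊤)
    (v : X → ℝ) (hv : CurveContinuous v) :
    AEMeasurable v (μH[1] : Measure X) := by
  obtain ⟨L, f, hf, hsurj⟩ := aux_lipschitz h1
  obtain ⟨γ, hγ⟩ := aux_curve L f hf
  have hcont : Continuous v := by
    rw [continuous_iff_isClosed]
    intro C hC
    have hK : IsCompact (Set.Icc 0 γ.len ∩ (v ∘ γ.toFun) ⁻¹' C) :=
      isCompact_Icc.of_isClosed_subset ((hv γ).preimage_isClosed_of_isClosed isClosed_Icc hC)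
        inter_subset_left
    have e : v ⁻¹' C = γ.toFun '' (Set.Icc 0 γ.len ∩ (v ∘ γ.toFun) ⁻¹' C) := by
      ext x
      constructor
      · intro hx
        obtain ⟨t, ht, rfl⟩ := hsurj x
        obtain ⟨s, hs, hst⟩ := hγ t ht
        exact ⟨s, ⟨hs, by simpa [hst] using hx⟩, hst⟩
      · rintro ⟨s, ⟨-, hs⟩, rfl⟩
        exact hs
    rw [e]
    exact (hK.image_of_continuousOn ((aux_curve_cont γ).mono inter_subset_left)).isClosed
  exact hcont.measurable.aemeasurable
end
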